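/- arXiv:2309.13615 — 2 statements merged into one kernel-verified Lean document; each statement's English description precedes it below -/
import Mathlib

section
/- For every r-colored composition (α,ε) of n, there exists a bijection from the colored descent class D_{(α,ε)} = {(π,z) ∈ S_{n,r} : co(π,z) = (α,ε)} to the set SYT(λ_{Z_{(α,ε)}}) of standard Young r-partite tableaux of shape λ_{Z_{(α,ε)}}, sending (π,z) to a tableau Q such that sDes(Q) = sDes((π,z)̄⁻¹). In particular, the distribution of the colored descent set is the same over the conjugate-inverse colored descent class D̄_{(α,ε)}⁻¹ = {(π,z) : co((π,z)̄⁻¹) = (α,ε)} and over SYT(λ_{Z_{(α,ε)}}). -/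
/-- Auxiliary construction of the cells of a ribbon: each part of the list
contributes a row, rows are read from bottom to top (in English (row, column)
coordinates the row coordinate decreases as we go up), and each new row starts
in the column of the last cell of the previous row. -/
def ribbonAux : List ℕ → ℤ × ℤ → Finset (ℤ × ℤ)
  | [], _ => ∅
  | a :: rest, p =>
      ((Finset.range a).image fun j : ℕ => (p.1, p.2 + (j : ℤ))) ∪
        ribbonAux rest (p.1 - 1, p.2 + (a : ℤ) - 1)

/-- The cells of the ribbon (zigzag diagram) whose row lengths, read from
bottom to top, are the entries of `l`. -/
def ribbonOfList (l : List ℕ) : Finset (ℤ × ℤ) := ribbonAux l (0, 0)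
/-- The rainbow decomposition of a colored list: the unique way of grouping
adjacent entries of equal color into maximal monochromatic blocks.  Each block
is recorded as (list of first components, common color). -/
def rainbow {r : ℕ} : List (ℕ × Fin r) → List (List ℕ × Fin r)
  | [] => []
  | (a, c) :: rest =>
    match rainbow rest with
    | [] => [([a], c)]
    | (b, c') :: bs =>
        if c = c' then (a :: b, c') :: bs else ([a], c) :: (b, c') :: bs
/-- The colored descent composition of a colored word (a list of
(letter, color) pairs): it records the lengths of the maximal increasing runs
of constant color, together with their colors. -/
def cco {r : ℕ} : List (ℕ × Fin r) → List (ℕ × Fin r)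
  | [] => []
  | (a, c) :: rest =>
    match cco rest, rest with
    | (m, c0) :: t, (b, c') :: _ =>
        if c = c' ∧ a < b then (m + 1, c) :: t else (1, c) :: (m, c0) :: t
    | _, _ => [(1, c)]

/-- The window word of the colored permutation `(π, z)`:
the list `π₁^{z₁} π₂^{z₂} ⋯ π_n^{z_n}` of colored letters. -/
def cword {n r : ℕ} (π : Equiv.Perm (Fin n)) (z : Fin n → Fin r) :
    List (ℕ × Fin r) :=
  (List.finRange n).map fun i => ((π i : ℕ), z i)
/-- The direct sum `A ⊕ B` of two (skew) shapes given by their cell sets: `B`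
is translated so that its lower-left vertex coincides with the upper-right
vertex of `A` (in English coordinates, where the row coordinate increases
downwards). -/
noncomputable def dsum (A B : Finset (ℤ × ℤ)) : Finset (ℤ × ℤ) :=
  if hA : A.Nonempty then
    if hB : B.Nonempty then
      A ∪ B.image fun c =>
        (c.1 - (B.image Prod.fst).max' (hB.image _) + (A.image Prod.fst).min' (hA.image _) - 1,
         c.2 - (B.image Prod.snd).min' (hB.image _) + (A.image Prod.snd).max' (hA.image _) + 1)
    else A
  else B

/-- The colored zigzag shape `Z_{(α,ε)}` of a colored composition: the ribbons
of the blocks of the rainbow decomposition, with their colors. -/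
def zigzagOf {r : ℕ} (l : List (ℕ × Fin r)) : List (Finset (ℤ × ℤ) × Fin r) :=
  (rainbow l).map fun b => (ribbonOfList b.1, b.2)

/-- The `r`-partite skew shape `λ_{Z_{(α,ε)}}` associated with a colored
composition: its part of color `j` is the direct sum of the ribbons of color
`j` of the colored zigzag shape `Z_{(α,ε)}`, in order. -/
noncomputable def partiteShape {r : ℕ} (l : List (ℕ × Fin r)) :
    Fin r → Finset (ℤ × ℤ) := fun j =>
  ((((zigzagOf l).filter fun p => p.2 = j)).map Prod.fst).foldl dsum ∅

/-- `T` is a standard Young `r`-partite tableau of the `r`-partite shape `sh`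
with `n` cells in total: each part is zero off its shape, entries are in
`{1, …, n}`, every element of `{1, …, n}` appears exactly once in exactly one
part, and each part increases along rows and down columns. -/
def IsPartiteSYT {r : ℕ} (sh : Fin r → Finset (ℤ × ℤ)) (n : ℕ)
    (T : Fin r → ℤ × ℤ → ℕ) : Prop :=
  (∀ j, ∀ c ∉ sh j, T j c = 0) ∧
  (∀ j, ∀ c ∈ sh j, T j c ∈ Finset.Icc 1 n) ∧
  (∀ m ∈ Finset.Icc 1 n, ∃! p : Fin r × (ℤ × ℤ), p.2 ∈ sh p.1 ∧ T p.1 p.2 = m) ∧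
  (∀ j, ∀ c ∈ sh j, (c.1, c.2 + 1) ∈ sh j → T j c < T j (c.1, c.2 + 1)) ∧
  (∀ j, ∀ c ∈ sh j, (c.1 + 1, c.2) ∈ sh j → T j c < T j (c.1 + 1, c.2))
/-- The colored descent set `sDes(π, z) = (S⁺, ζ)` of a colored permutation,
encoded as the set of pairs `(s, ζ(s))` for `s ∈ S⁺ = S ∪ {n}`: here
`S = {i ∈ [n-1] : z_i ≠ z_{i+1}, or z_i = z_{i+1} and π_i > π_{i+1}}` and
`ζ(i) = z_i`. -/
def sDesPermSet {n r : ℕ} (π : Equiv.Perm (Fin n)) (z : Fin n → Fin r) :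
    Set (ℕ × Fin r) :=
  {p | (∃ (h1 : 1 ≤ p.1) (h2 : p.1 < n),
          (z ⟨p.1 - 1, by omega⟩ ≠ z ⟨p.1, h2⟩ ∨
            (z ⟨p.1 - 1, by omega⟩ = z ⟨p.1, h2⟩ ∧
              (π ⟨p.1, h2⟩ : ℕ) < (π ⟨p.1 - 1, by omega⟩ : ℕ))) ∧
          p.2 = z ⟨p.1 - 1, by omega⟩) ∨
        (∃ _ : 0 < n, p.1 = n ∧ p.2 = z ⟨n - 1, by omega⟩)}

/-- The colored descent set `sDes(Q) = (S⁺, ζ)` of an `r`-partite tableau,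
encoded as the set of pairs `(s, ζ(s))` for `s ∈ S⁺ = S ∪ {n}`: here `S`
consists of the `i ∈ [n-1]` such that `i` and `i+1` lie in parts of different
colors, or lie in the same part with `i+1` in a lower row than `i`, and `ζ(i)`
is the color of the part containing `i`. -/
def sDesTabSet {r : ℕ} (sh : Fin r → Finset (ℤ × ℤ)) (n : ℕ)
    (T : Fin r → ℤ × ℤ → ℕ) : Set (ℕ × Fin r) :=
  {p | ∃ j, ∃ c ∈ sh j, T j c = p.1 ∧ p.2 = j ∧
        (p.1 = n ∨
          ∃ j', ∃ c' ∈ sh j', T j' c' = p.1 + 1 ∧ (j ≠ j' ∨ c.1 < c'.1))}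

section RunComposition

variable {β γ : Type*} {r : ℕ}

/-- The composition recording the lengths and colors of the maximal runs of a colored word in which
consecutive letters have the same color and are related by `R`. -/
def runComp (R : β → β → Prop) [DecidableRel R] : List (β × Fin r) → List (ℕ × Fin r)
  | [] => []
  | (a, c) :: rest =>
    match runComp R rest, rest with
    | (m, c0) :: t, (b, c') :: _ =>
        if c = c' ∧ R a b then (m + 1, c) :: t else (1, c) :: (m, c0) :: t
    | _, _ => [(1, c)]

theorem cco_eq_runComp (u : List (ℕ × Fin r)) : cco u = runComp (· < ·) u := by
  induction u with
  | nil => rfl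
  | cons x u ih =>
    unfold cco runComp
    rw [ih]
    rcases runComp (fun a b : ℕ => a < b) u with _ | ⟨_, _⟩ <;> cases u <;> rfl

variable (R : β → β → Prop) [DecidableRel R] (R' : γ → γ → Prop) [DecidableRel R']

theorem exists_runComp_cons (u : List (β × Fin r)) (x : β × Fin r) :
    ∃ m t, runComp R (x :: u) = (m + 1, x.2) :: t := by
  induction u generalizing x with
  | nil => exact ⟨0, [], rfl⟩
  | cons y u ih =>
    obtain ⟨m, t, h⟩ := ih y
    unfold runComp
    rw [h]
    by_cases hxy : x.2 = y.2 ∧ R x.1 y.1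
    · exact ⟨m + 1, t, by simp [hxy]⟩
    · exact ⟨0, (m + 1, y.2) :: t, by simp only [hxy, if_false, zero_add]⟩

theorem runComp_cons_cons {u : List (β × Fin r)} {x y : β × Fin r} {m : ℕ}
    {t : List (ℕ × Fin r)} (h : runComp R (y :: u) = (m, y.2) :: t) :
    runComp R (x :: y :: u) =
      if x.2 = y.2 ∧ R x.1 y.1 then (m + 1, x.2) :: t else (1, x.2) :: (m, y.2) :: t := by
  rw [show runComp R (x :: y :: u) = _ from by unfold runComp; rfl, h]

theorem runComp_eq_iff (u : List (β × Fin r)) (v : List (γ × Fin r)) :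
    runComp R u = runComp R' v ↔ u.map Prod.snd = v.map Prod.snd ∧
      ∀ (i : ℕ) (h : i + 1 < u.length) (h' : i + 1 < v.length), u[i].2 = u[i + 1].2 →
        (R u[i].1 u[i + 1].1 ↔ R' v[i].1 v[i + 1].1) := by
  induction u generalizing v with
  | nil =>
    cases v with
    | nil => simp [runComp]
    | cons y v =>
      obtain ⟨m, t, h⟩ := exists_runComp_cons R' v y
      rw [h]
      simp [runComp]
  | cons x u ih =>
    cases v with
    | nil =>
      obtain ⟨m, t, h⟩ := exists_runComp_cons R u x
      rw [h]
      simp [runComp]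
    | cons x' v =>
      cases u with
      | nil =>
        cases v with
        | nil => simp [runComp]
        | cons y' v =>
          obtain ⟨m, t, h⟩ := exists_runComp_cons R' v y'
          rw [runComp_cons_cons R' h]
          simp only [runComp]
          split_ifs <;> simp
      | cons y u =>
        cases v with
        | nil =>
          obtain ⟨m, t, h⟩ := exists_runComp_cons R u y
          rw [runComp_cons_cons R h]
          simp only [runComp]
          split_ifs <;> simp
        | cons y' v =>
          obtain ⟨m, t, h⟩ := exists_runComp_cons R u y
          obtain ⟨m', t', h'⟩ := exists_runComp_cons R' v y'
          have key : runComp R (x :: y :: u) = runComp R' (x' :: y' :: v) ↔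
              x.2 = x'.2 ∧ (x.2 = y.2 → (R x.1 y.1 ↔ R' x'.1 y'.1)) ∧
                runComp R (y :: u) = runComp R' (y' :: v) := by
            rw [runComp_cons_cons R h, runComp_cons_cons R' h', h, h']
            split_ifs <;> grind
          rw [key, ih (y' :: v)]
          constructor
          · rintro ⟨h1, h2, h3, h4⟩
            refine ⟨by simpa using ⟨h1, by simpa using h3⟩, fun i hi hi' => ?_⟩
            cases i with
            | zero => exact h2
            | succ i => exact h4 i (by simpa using hi) (by simpa using hi')
          · rintro ⟨h1, h2⟩
            rw [List.map_cons, List.map_cons (l := y' :: v), List.cons.injEq] at h1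
            exact ⟨h1.1, h2 0 (by simp) (by simp), h1.2,
              fun i hi hi' => h2 (i + 1) (by simpa using hi) (by simpa using hi')⟩

theorem runComp_append {u v : List (β × Fin r)}
    (h : ∀ x ∈ u.getLast?, ∀ y ∈ v.head?, ¬ (x.2 = y.2 ∧ R x.1 y.1)) :
    runComp R (u ++ v) = runComp R u ++ runComp R v := by
  induction u with
  | nil => rfl
  | cons x u ih =>
    cases u with
    | nil =>
      cases v with
      | nil => simp [runComp]
      | cons y v =>
        obtain ⟨m, t, hv⟩ := exists_runComp_cons R v y
        have := h x (by simp) y (by simp)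
        rw [List.singleton_append, runComp_cons_cons R hv, if_neg this, hv]
        simp [runComp]
    | cons y u =>
      have ih := ih (by simpa using h)
      obtain ⟨m, t, hu⟩ := exists_runComp_cons R u y
      rw [hu, List.cons_append, List.cons_append] at ih
      rw [List.cons_append, List.cons_append, runComp_cons_cons R ih, runComp_cons_cons R hu]
      split_ifs <;> simp

theorem sum_runComp (u : List (β × Fin r)) : ((runComp R u).map Prod.fst).sum = u.length := by
  induction u with
  | nil => rfl
  | cons x u ih =>
    cases u with
    | nil => simp [runComp]
    | cons y u =>
      obtain ⟨m, t, h⟩ := exists_runComp_cons R u y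
      rw [runComp_cons_cons R h]
      rw [h] at ih
      simp only [List.map_cons, List.sum_cons, List.length_cons] at ih ⊢
      split_ifs <;> simp <;> omega

theorem runComp_of_isChain (x : β × Fin r) (u : List (β × Fin r))
    (h : (x :: u).IsChain fun x y => x.2 = y.2 ∧ R x.1 y.1) :
    runComp R (x :: u) = [(u.length + 1, x.2)] := by
  induction u generalizing x with
  | nil => rfl
  | cons y u ih =>
    rw [List.isChain_cons_cons] at h
    rw [runComp_cons_cons R (ih y h.2), if_pos h.1, List.length_cons]

end RunComposition

section Rainbow

variable {r : ℕ}

theorem rainbow_flatMap (l : List (ℕ × Fin r)) :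
    ((rainbow l).flatMap fun b => b.1.map fun a => (a, b.2)) = l := by
  induction l with
  | nil => rfl
  | cons x l ih =>
    unfold rainbow
    rcases h : rainbow l with _ | ⟨b, bs⟩
    · rw [h] at ih
      simp [← ih]
    · rw [h] at ih
      by_cases hc : x.2 = b.2
      · simp [hc, ← ih]
        exact Prod.ext rfl hc.symm
      · simp [hc, ← ih]

theorem rainbow_fst_ne_nil (l : List (ℕ × Fin r)) : ∀ b ∈ rainbow l, b.1 ≠ [] := by
  induction l with
  | nil => simp [rainbow]
  | cons x l ih =>
    unfold rainbow
    rcases h : rainbow l with _ | ⟨b, bs⟩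
    · simp
    · rw [h] at ih
      by_cases hc : x.2 = b.2
      · simpa [hc] using fun a ha => ih a (by simp [ha])
      · simpa [hc] using ih

theorem isChain_rainbow (l : List (ℕ × Fin r)) : (rainbow l).IsChain fun b b' => b.2 ≠ b'.2 := by
  induction l with
  | nil => simp [rainbow]
  | cons x l ih =>
    unfold rainbow
    rcases h : rainbow l with _ | ⟨b, bs⟩
    · simp
    · rw [h] at ih
      by_cases hc : x.2 = b.2
      · simp only [hc, if_true]
        cases bs with
        | nil => simp
        | cons d bs => simpa using ih
      · simp only [hc, if_false]
        simpa using ⟨hc, ih⟩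

end Rainbow

section Ribbon

/-- The cells of a ribbon, listed from its lower-left end to its upper-right end. -/
def ribbonCells : List ℕ → ℤ × ℤ → List (ℤ × ℤ)
  | [], _ => []
  | a :: l, p =>
      ((List.range a).map fun j : ℕ => (p.1, p.2 + (j : ℤ))) ++
        ribbonCells l (p.1 - 1, p.2 + (a : ℤ) - 1)

theorem mem_ribbonCells {l : List ℕ} {p c : ℤ × ℤ} : c ∈ ribbonCells l p ↔ c ∈ ribbonAux l p := by
  induction l generalizing p with
  | nil => simp [ribbonCells, ribbonAux]
  | cons a l ih => simp [ribbonCells, ribbonAux, ih]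

theorem ribbonAux_add (l : List ℕ) (p q : ℤ × ℤ) :
    ribbonAux l (p + q) = (ribbonAux l p).image (· + q) := by
  induction l generalizing p with
  | nil => simp [ribbonAux]
  | cons a l ih =>
    simp only [ribbonAux, Finset.image_union, Finset.image_image, ← ih]
    congr 2
    · funext j
      ext <;> simp
      ring
    · ext <;> simp <;> ring

theorem ribbonAux_bounds {l : List ℕ} (hl : ∀ a ∈ l, 0 < a) {p c : ℤ × ℤ}
    (hc : c ∈ ribbonAux l p) : c.1 ≤ p.1 ∧ p.2 ≤ c.2 := by
  induction l generalizing p with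
  | nil => simp [ribbonAux] at hc
  | cons a l ih =>
    simp only [ribbonAux, Finset.mem_union, Finset.mem_image, Finset.mem_range] at hc
    have ha := hl a (by simp)
    rcases hc with ⟨j, _, rfl⟩ | hc
    · simp
    · have := ih (fun b hb => hl b (by simp [hb])) hc
      simp only at this
      omega

theorem head?_ribbonCells {l : List ℕ} (hl : ∀ a ∈ l, 0 < a) {p c : ℤ × ℤ}
    (hc : c ∈ (ribbonCells l p).head?) : c = p := by
  cases l with
  | nil => simp [ribbonCells] at hc
  | cons a l =>
    obtain ⟨b, rfl⟩ := Nat.exists_eq_succ_of_ne_zero (hl a (by simp)).ne'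
    simp [ribbonCells, List.range_succ_eq_map] at hc
    exact hc.symm

theorem getLast?_row {a : ℕ} {p c : ℤ × ℤ}
    (hc : c ∈ ((List.range a).map fun j : ℕ => (p.1, p.2 + (j : ℤ))).getLast?) :
    c = (p.1, p.2 + (a : ℤ) - 1) := by
  cases a with
  | zero => simp at hc
  | succ a =>
    simp [List.range_succ] at hc
    rw [← hc]
    ext <;> simp
    ring

theorem self_mem_ribbonAux {l : List ℕ} (hl : ∀ a ∈ l, 0 < a) (hne : l ≠ []) (p : ℤ × ℤ) :
    p ∈ ribbonAux l p := by
  cases l with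
  | nil => exact absurd rfl hne
  | cons a l =>
    simp only [ribbonAux, Finset.mem_union, Finset.mem_image, Finset.mem_range]
    exact Or.inl ⟨0, hl a (by simp), by simp⟩

theorem pairwise_ribbonCells {l : List ℕ} (hl : ∀ a ∈ l, 0 < a) (p : ℤ × ℤ) :
    (ribbonCells l p).Pairwise fun x y => y.1 ≤ x.1 ∧ x.2 ≤ y.2 ∧ x.2 - x.1 < y.2 - y.1 := by
  induction l generalizing p with
  | nil => simp [ribbonCells]
  | cons a l ih =>
    have hl' : ∀ b ∈ l, 0 < b := fun b hb => hl b (by simp [hb])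
    rw [ribbonCells, List.pairwise_append]
    refine ⟨?_, ih hl' _, ?_⟩
    · rw [List.pairwise_map]
      refine List.pairwise_lt_range.imp fun {i j} hij => ?_
      simp only
      omega
    · intro x hx y hy
      have := ribbonAux_bounds hl' (mem_ribbonCells.1 hy)
      simp only [List.mem_map, List.mem_range] at hx
      obtain ⟨j, hj, rfl⟩ := hx
      simp only at this ⊢
      omega

theorem isChain_ribbonCells {l : List ℕ} (hl : ∀ a ∈ l, 0 < a) (p : ℤ × ℤ) :
    (ribbonCells l p).IsChain fun x y => y = (x.1, x.2 + 1) ∨ y = (x.1 - 1, x.2) := by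
  induction l generalizing p with
  | nil => simp [ribbonCells]
  | cons a l ih =>
    have hl' : ∀ b ∈ l, 0 < b := fun b hb => hl b (by simp [hb])
    rw [ribbonCells, List.isChain_append]
    refine ⟨?_, ih hl' _, ?_⟩
    · rw [List.isChain_map, List.isChain_iff_getElem]
      intro i hi
      left
      ext <;> simp
      ring
    · intro x hx y hy
      rw [getLast?_row hx, head?_ribbonCells hl' hy]
      right
      ext <;> simp

/-- Two decorated cells lie in the same row. -/
def SameRow (x y : (ℤ × ℤ) × ℕ) : Prop := x.1.1 = y.1.1

instance : DecidableRel SameRow := fun x y => inferInstanceAs (Decidable (x.1.1 = y.1.1))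

theorem runComp_ribbonCells {r : ℕ} {l : List ℕ} (hl : ∀ a ∈ l, 0 < a) (p : ℤ × ℤ) (k : ℕ)
    (j : Fin r) :
    runComp SameRow ((ribbonCells l p).map fun c => ((c, k), j)) = l.map fun a => (a, j) := by
  induction l generalizing p with
  | nil => rfl
  | cons a l ih =>
    have hl' : ∀ b ∈ l, 0 < b := fun b hb => hl b (by simp [hb])
    rw [ribbonCells, List.map_append, runComp_append, ih hl']
    · obtain ⟨b, rfl⟩ := Nat.exists_eq_succ_of_ne_zero (hl a (by simp)).ne'
      rw [List.range_succ_eq_map, List.map_cons, List.map_cons, runComp_of_isChain]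
      · simp
      · rw [← List.map_cons (f := fun c : ℤ × ℤ => ((c, k), j)),
          ← List.map_cons (f := fun j : ℕ => (p.1, p.2 + (j : ℤ))), ← List.range_succ_eq_map,
          List.map_map, List.isChain_map, List.isChain_iff_getElem]
        intro i hi
        exact ⟨rfl, rfl⟩
    · intro x hx y hy
      simp only [List.getLast?_map, List.head?_map, Option.mem_map] at hx hy
      obtain ⟨x, hx, rfl⟩ := hx
      obtain ⟨y, hy, rfl⟩ := hy
      rw [head?_ribbonCells hl' hy]
      have hx' : x ∈ ((List.range a).map fun j : ℕ => (p.1, p.2 + (j : ℤ))).getLast? := by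
        simpa only [List.getLast?_map, Option.mem_map] using hx
      rw [getLast?_row hx']
      rintro ⟨-, h⟩
      simp only [SameRow] at h
      omega

theorem exists_dsum_ribbonOfList (A : Finset (ℤ × ℤ)) {l : List ℕ} (hl : ∀ a ∈ l, 0 < a)
    (hne : l ≠ []) :
    ∃ p : ℤ × ℤ, dsum A (ribbonOfList l) = A ∪ ribbonAux l p ∧
      ∀ c ∈ A, p.1 < c.1 ∧ c.2 < p.2 := by
  have hB : (ribbonOfList l).Nonempty := ⟨_, self_mem_ribbonAux hl hne _⟩
  rcases A.eq_empty_or_nonempty with rfl | hA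
  · exact ⟨(0, 0), by simp [dsum, ribbonOfList], by simp⟩
  · have hmax : ((ribbonOfList l).image Prod.fst).max' (hB.image _) = 0 := by
      refine le_antisymm (Finset.max'_le _ _ _ fun y hy => ?_) (Finset.le_max' _ _ ?_)
      · obtain ⟨c, hc, rfl⟩ := Finset.mem_image.1 hy
        exact (ribbonAux_bounds hl hc).1
      · exact Finset.mem_image.2 ⟨(0, 0), self_mem_ribbonAux hl hne _, rfl⟩
    have hmin : ((ribbonOfList l).image Prod.snd).min' (hB.image _) = 0 := by
      refine le_antisymm (Finset.min'_le _ _ ?_) (Finset.le_min' _ _ _ fun y hy => ?_)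
      · exact Finset.mem_image.2 ⟨(0, 0), self_mem_ribbonAux hl hne _, rfl⟩
      · obtain ⟨c, hc, rfl⟩ := Finset.mem_image.1 hy
        exact (ribbonAux_bounds hl hc).2
    refine ⟨((A.image Prod.fst).min' (hA.image _) - 1, (A.image Prod.snd).max' (hA.image _) + 1),
      ?_, fun c hc => ⟨?_, ?_⟩⟩
    · rw [dsum, dif_pos hA, dif_pos hB, hmax, hmin]
      rw [← zero_add (((A.image Prod.fst).min' (hA.image _) - 1,
        (A.image Prod.snd).max' (hA.image _) + 1) : ℤ × ℤ), ribbonAux_add]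
      congr 1
      refine Finset.image_congr fun c _ => ?_
      ext <;> simp <;> ring
    · have := Finset.min'_le (A.image Prod.fst) c.1 (Finset.mem_image_of_mem _ hc)
      simp only
      omega
    · have := Finset.le_max' (A.image Prod.snd) c.2 (Finset.mem_image_of_mem _ hc)
      simp only
      omega

end Ribbon

section Reading

variable {r : ℕ}

/-- The `r`-partite shape obtained from a list of colored blocks by taking, for each color, the
direct sum of the ribbons of that color. -/
noncomputable def blockShape (bs : List (List ℕ × Fin r)) : Fin r → Finset (ℤ × ℤ) := fun j =>
  (((bs.map fun b => (ribbonOfList b.1, b.2)).filter fun p => p.2 = j).map Prod.fst).foldl dsum ∅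

theorem blockShape_concat (bs : List (List ℕ × Fin r)) (b : List ℕ × Fin r) (j : Fin r) :
    blockShape (bs ++ [b]) j =
      if b.2 = j then dsum (blockShape bs j) (ribbonOfList b.1) else blockShape bs j := by
  by_cases h : b.2 = j <;> simp [blockShape, List.filter_append, h]

/-- Relative position of two cells, each decorated with the index of its block and its color, when
the first precedes the second in the reading order. -/
def ReadBefore (x y : ((ℤ × ℤ) × ℕ) × Fin r) : Prop :=
  x.1.2 ≤ y.1.2 ∧ (x.1.2 = y.1.2 → x.2 = y.2) ∧
    (x.2 = y.2 → y.1.1.1 ≤ x.1.1.1 ∧ x.1.1.2 ≤ y.1.1.2 ∧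
      x.1.1.2 - x.1.1.1 < y.1.1.2 - y.1.1.1 ∧
      (x.1.2 < y.1.2 → y.1.1.1 < x.1.1.1 ∧ x.1.1.2 < y.1.1.2))

/-- A listing of the cells of the direct sums of ribbons determined by a list of colored blocks,
block by block and along each ribbon from lower left to upper right. -/
structure IsBlockReading (bs : List (List ℕ × Fin r)) (W : List (((ℤ × ℤ) × ℕ) × Fin r)) :
    Prop where
  mem_iff : ∀ j c, c ∈ blockShape bs j ↔ ∃ k, ((c, k), j) ∈ W
  runComp_eq : runComp SameRow W = bs.flatMap fun b => b.1.map fun a => (a, b.2)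
  pairwise : W.Pairwise ReadBefore
  isChain : W.IsChain fun x y => x.2 = y.2 →
    y.1.1 = (x.1.1.1, x.1.1.2 + 1) ∨ y.1.1 = (x.1.1.1 - 1, x.1.1.2)
  index_lt : ∀ x ∈ W, x.1.2 < bs.length
  getLast?_color : ∀ x ∈ W.getLast?, ∃ b ∈ bs.getLast?, x.2 = b.2

theorem exists_isBlockReading (bs : List (List ℕ × Fin r))
    (hne : ∀ b ∈ bs, b.1 ≠ []) (hpos : ∀ b ∈ bs, ∀ a ∈ b.1, 0 < a)
    (hc : bs.IsChain fun b b' => b.2 ≠ b'.2) : ∃ W, IsBlockReading bs W := by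
  induction bs using List.reverseRecOn with
  | nil => exact ⟨[], by simp [blockShape], rfl, by simp, by simp, by simp, by simp⟩
  | append_singleton bs b ih =>
    rw [List.isChain_append] at hc
    obtain ⟨W, hW⟩ := ih (fun b hb => hne b (by simp [hb])) (fun b hb => hpos b (by simp [hb])) hc.1
    have hb := hpos b (by simp)
    obtain ⟨p, hp, hA⟩ := exists_dsum_ribbonOfList (blockShape bs b.2) hb (hne b (by simp))
    have hlast : ∀ x ∈ W.getLast?, x.2 ≠ b.2 := by
      intro x hx
      obtain ⟨b', hb', h⟩ := hW.getLast?_color x hx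
      rw [h]
      exact hc.2.2 b' hb' b (by simp)
    refine ⟨W ++ (ribbonCells b.1 p).map fun c => ((c, bs.length), b.2), ?_, ?_, ?_, ?_, ?_, ?_⟩
    · intro j c
      rw [blockShape_concat]
      split_ifs with h
      · subst h
        rw [hp, Finset.mem_union, hW.mem_iff, ← mem_ribbonCells]
        simp [exists_or, -Prod.exists]
      · rw [hW.mem_iff]
        simp [h]
    · rw [runComp_append, hW.runComp_eq, runComp_ribbonCells hb]
      · simp
      · intro x hx y hy h
        simp only [List.head?_map, Option.mem_map] at hy
        obtain ⟨y, hy, rfl⟩ := hy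
        exact hlast x hx h.1
    · rw [List.pairwise_append]
      refine ⟨hW.pairwise, ?_, ?_⟩
      · rw [List.pairwise_map]
        refine (pairwise_ribbonCells hb p).imp fun {x y} h => ?_
        exact ⟨le_rfl, fun _ => rfl, fun _ => ⟨h.1, h.2.1, h.2.2, fun h' => absurd h' (lt_irrefl _)⟩⟩
      · intro x hx y hy
        simp only [List.mem_map] at hy
        obtain ⟨y, hy, rfl⟩ := hy
        have h1 := hW.index_lt x hx
        have h2 := ribbonAux_bounds hb (mem_ribbonCells.1 hy)
        refine ⟨h1.le, fun h => absurd h h1.ne, fun h => ?_⟩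
        have h3 := hA x.1.1 ((hW.mem_iff _ _).2 ⟨x.1.2, by rw [← (show x.2 = b.2 from h)]; exact hx⟩)
        simp only
        omega
    · rw [List.isChain_append]
      refine ⟨hW.isChain, ?_, ?_⟩
      · rw [List.isChain_map]
        exact (isChain_ribbonCells hb p).imp fun x y h _ => h
      · intro x hx y hy h
        simp only [List.head?_map, Option.mem_map] at hy
        obtain ⟨y, hy, rfl⟩ := hy
        exact absurd h (hlast x hx)
    · intro x hx
      rw [List.length_append, List.length_singleton]
      rcases List.mem_append.1 hx with hx | hx
      · exact (hW.index_lt x hx).trans (Nat.lt_succ_self _)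
      · obtain ⟨c, _, rfl⟩ := List.mem_map.1 hx
        exact Nat.lt_succ_self _
    · intro x hx
      have hnil : ((ribbonCells b.1 p).map fun c => ((c, bs.length), b.2)) ≠ [] := fun h => by
        have := mem_ribbonCells.2 (self_mem_ribbonAux hb (hne b (by simp)) p)
        simp [List.map_eq_nil_iff.1 h] at this
      rw [List.getLast?_append_of_ne_nil _ hnil] at hx
      obtain ⟨c, _, rfl⟩ := List.mem_map.1 (List.mem_of_getLast? hx)
      exact ⟨b, by simp, rfl⟩

/-- An enumeration of the cells of the `r`-partite shape of a colored composition of `n`, compatible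
with the reading of colored words having that colored descent composition. -/
structure IsReading {n : ℕ} (l : List (ℕ × Fin r)) (color : Fin n → Fin r)
    (cell : Fin n → ℤ × ℤ) : Prop where
  mem_iff : ∀ j c, c ∈ partiteShape l j ↔ ∃ i, color i = j ∧ cell i = c
  cco_eq_iff : ∀ (π : Equiv.Perm (Fin n)) (z : Fin n → Fin r), cco (cword π z) = l ↔
    z = color ∧ ∀ i k : Fin n, (k : ℕ) = i + 1 → color i = color k →
      ((cell i).1 = (cell k).1 ↔ π i < π k)
  bounds : ∀ i k, i < k → color i = color k → (cell k).1 ≤ (cell i).1 ∧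
    (cell i).2 ≤ (cell k).2 ∧ (cell i).2 - (cell i).1 < (cell k).2 - (cell k).1
  between : ∀ i m k, i < m → m < k → color i = color k →
    ((cell i).1 = (cell k).1 ∨ (cell i).2 = (cell k).2) → color m = color i
  step : ∀ i k : Fin n, (k : ℕ) = i + 1 → color i = color k →
    cell k = ((cell i).1, (cell i).2 + 1) ∨ cell k = ((cell i).1 - 1, (cell i).2)

theorem exists_isReading {n : ℕ} (l : List (ℕ × Fin r)) (hpos : ∀ p ∈ l, 0 < p.1)
    (hsum : (l.map Prod.fst).sum = n) :
    ∃ (color : Fin n → Fin r) (cell : Fin n → ℤ × ℤ), IsReading l color cell := by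
  obtain ⟨W, hW⟩ := exists_isBlockReading (rainbow l) (rainbow_fst_ne_nil l)
    (fun b hb a ha => by
      have : (a, b.2) ∈ l := by
        rw [← rainbow_flatMap l]
        exact List.mem_flatMap.2 ⟨b, hb, List.mem_map.2 ⟨a, ha, rfl⟩⟩
      exact hpos _ this) (isChain_rainbow l)
  have hrun : runComp SameRow W = l := hW.runComp_eq.trans (rainbow_flatMap l)
  have hlen : W.length = n := by rw [← hsum, ← hrun, sum_runComp]
  subst hlen
  have hbefore : ∀ i k : Fin W.length, i < k → ReadBefore W[i] W[k] := fun i k h =>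
    List.pairwise_iff_getElem.1 hW.pairwise i k i.2 k.2 h
  refine ⟨fun i => W[i].2, fun i => W[i].1.1, ?_, ?_, ?_, ?_, ?_⟩
  · intro j c
    refine (hW.mem_iff j c).trans ⟨?_, ?_⟩
    · rintro ⟨k, hk⟩
      obtain ⟨i, hi, h⟩ := List.mem_iff_getElem.1 hk
      exact ⟨⟨i, hi⟩, by simp [h]⟩
    · rintro ⟨i, rfl, rfl⟩
      exact ⟨W[i].1.2, List.getElem_mem i.2⟩
  · intro π z
    rw [cco_eq_runComp]
    rw [← hrun, runComp_eq_iff]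
    have hz : (cword π z).map Prod.snd = W.map Prod.snd ↔ z = fun i => W[i].2 := by
      constructor
      · intro h
        funext i
        have := List.getElem_of_eq h (i := i) (by simp [cword])
        simpa [cword] using this
      · rintro rfl
        refine List.ext_getElem (by simp [cword]) fun i h1 h2 => ?_
        simp [cword]
    rw [hz]
    refine and_congr_right fun h => ?_
    subst h
    constructor
    · intro h i k hk hc
      obtain ⟨k, hk'⟩ := k
      simp only at hk
      subst hk
      have := h i (by simpa [cword] using hk') hk' (by simpa [cword] using hc)
      simp only [cword, SameRow, List.getElem_map, List.getElem_finRange] at this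
      exact this.symm
    · intro h i hi hi' hc
      have := h ⟨i, by omega⟩ ⟨i + 1, hi'⟩ rfl (by simpa [cword] using hc)
      simp only [cword, SameRow, List.getElem_map, List.getElem_finRange]
      exact this.symm
  · intro i k h hc
    have := (hbefore i k h).2.2 hc
    exact ⟨this.1, this.2.1, this.2.2.1⟩
  · intro i m k him hmk hc h
    obtain ⟨h1, h2, -⟩ := hbefore i m him
    obtain ⟨h3, -, -⟩ := hbefore m k hmk
    obtain ⟨-, -, h4⟩ := hbefore i k (him.trans hmk)
    have h5 := (h4 hc).2.2.2
    exact (h2 (by omega)).symm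
  · intro i k hk hc
    obtain ⟨k, hk'⟩ := k
    simp only at hk
    subst hk
    exact List.isChain_iff_getElem.1 hW.isChain i hk' hc

end Reading

namespace IsReading

variable {n r : ℕ} {l : List (ℕ × Fin r)} {color : Fin n → Fin r} {cell : Fin n → ℤ × ℤ}

theorem injective (h : IsReading l color cell) :
    Function.Injective fun i => (color i, cell i) := by
  have key : ∀ i k, i < k → color i = color k → cell i ≠ cell k := fun i k hik hc he => by
    have := (h.bounds i k hik hc).2.2
    rw [he] at this
    exact lt_irrefl _ this
  intro i k hik
  obtain ⟨h1, h2⟩ := Prod.mk.inj hik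
  rcases lt_trichotomy i k with hlt | heq | hlt
  · exact absurd h2 (key i k hlt h1)
  · exact heq
  · exact absurd h2.symm (key k i hlt h1.symm)

theorem mem (h : IsReading l color cell) (i : Fin n) : cell i ∈ partiteShape l (color i) :=
  (h.mem_iff _ _).2 ⟨i, rfl, rfl⟩

/-- Two cells of the same color in the same row or column, with contents differing by one, are
consecutive. -/
theorem eq_succ (h : IsReading l color cell) {i k : Fin n} (hc : color i = color k)
    (hrc : (cell i).1 = (cell k).1 ∨ (cell i).2 = (cell k).2)
    (hcont : (cell k).2 - (cell k).1 = (cell i).2 - (cell i).1 + 1) : (k : ℕ) = i + 1 := by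
  have hik : i < k := by
    rcases lt_trichotomy i k with hlt | heq | hlt
    · exact hlt
    · subst heq
      omega
    · have := (h.bounds k i hlt hc.symm).2.2
      omega
  by_contra hne
  have hlt : (i : ℕ) + 1 < k := by
    have : (i : ℕ) < k := hik
    omega
  let m : Fin n := ⟨i + 1, hlt.trans k.2⟩
  have him : i < m := Nat.lt_succ_self _
  have hmk : m < k := hlt
  have hm := h.between i m k him hmk hc hrc
  have h1 := (h.bounds i m him hm.symm).2.2
  have h2 := (h.bounds m k hmk (hm.trans hc)).2.2
  omega

theorem lt_of_row_eq (h : IsReading l color cell) {π : Equiv.Perm (Fin n)}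
    (hπ : cco (cword π color) = l) {i k : Fin n} (hik : i < k) (hc : color i = color k)
    (hrow : (cell i).1 = (cell k).1) : π i < π k := by
  have hstep := ((h.cco_eq_iff π color).1 hπ).2
  obtain ⟨k, hk⟩ := k
  induction k with
  | zero => exact absurd hik (Nat.not_lt_zero _)
  | succ k ih =>
    have hk' : k < n := (Nat.lt_succ_self k).trans hk
    rcases (Nat.lt_succ_iff.1 hik).lt_or_eq with hlt | heq
    · have him : i < ⟨k, hk'⟩ := hlt
      have hmk : (⟨k, hk'⟩ : Fin n) < ⟨k + 1, hk⟩ := Nat.lt_succ_self k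
      have hm := h.between i ⟨k, hk'⟩ ⟨k + 1, hk⟩ him hmk hc (Or.inl hrow)
      have h1 := (h.bounds i ⟨k, hk'⟩ him hm.symm).1
      have h2 := (h.bounds ⟨k, hk'⟩ ⟨k + 1, hk⟩ hmk (hm.trans hc)).1
      exact (ih hk' him hm.symm (by omega)).trans
        ((hstep ⟨k, hk'⟩ ⟨k + 1, hk⟩ rfl (hm.trans hc)).1 (by omega))
    · exact (hstep i ⟨k + 1, hk⟩ (by simp [heq]) hc).1 hrow

/-- The filling of the cells of a reading by the values of a permutation. -/
noncomputable def tableau (color : Fin n → Fin r) (cell : Fin n → ℤ × ℤ)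
    (π : Equiv.Perm (Fin n)) (j : Fin r) (c : ℤ × ℤ) : ℕ :=
  Function.extend (fun i => (color i, cell i)) (fun i => (π i : ℕ) + 1) 0 (j, c)

theorem tableau_apply (h : IsReading l color cell) (π : Equiv.Perm (Fin n)) (i : Fin n) :
    tableau color cell π (color i) (cell i) = π i + 1 :=
  h.injective.extend_apply _ _ i

theorem tableau_of_notMem (h : IsReading l color cell) (π : Equiv.Perm (Fin n)) {j : Fin r}
    {c : ℤ × ℤ} (hc : c ∉ partiteShape l j) : tableau color cell π j c = 0 :=
  Function.extend_apply' _ _ _ fun ⟨i, hi⟩ =>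
    hc ((h.mem_iff j c).2 ⟨i, (Prod.mk.inj hi).1, (Prod.mk.inj hi).2⟩)

theorem isPartiteSYT_tableau (h : IsReading l color cell) {π : Equiv.Perm (Fin n)}
    (hπ : cco (cword π color) = l) : IsPartiteSYT (partiteShape l) n (tableau color cell π) := by
  refine ⟨fun j c => h.tableau_of_notMem π, ?_, ?_, ?_, ?_⟩
  · intro j c hc
    obtain ⟨i, rfl, rfl⟩ := (h.mem_iff j c).1 hc
    rw [h.tableau_apply, Finset.mem_Icc]
    omega
  · intro m hm
    rw [Finset.mem_Icc] at hm
    have hlt : m - 1 < n := by omega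
    refine ⟨(color (π⁻¹ ⟨m - 1, hlt⟩), cell (π⁻¹ ⟨m - 1, hlt⟩)), ⟨h.mem _, ?_⟩, ?_⟩
    · rw [h.tableau_apply, Equiv.Perm.coe_inv, Equiv.apply_symm_apply]
      simp only
      omega
    · rintro ⟨j, c⟩ ⟨hc, hv⟩
      obtain ⟨i, rfl, rfl⟩ := (h.mem_iff j c).1 hc
      rw [h.tableau_apply] at hv
      have : i = π⁻¹ ⟨m - 1, hlt⟩ := by
        rw [Equiv.Perm.eq_inv_iff_eq]
        ext
        simp only
        omega
      rw [← this]
  · intro j c hc hc'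
    obtain ⟨i, rfl, rfl⟩ := (h.mem_iff j c).1 hc
    obtain ⟨k, hk, hck⟩ := (h.mem_iff _ _).1 hc'
    have hs := h.eq_succ hk.symm (by simp [hck]) (by simp [hck]; ring)
    rw [← hck, ← hk, h.tableau_apply, hk, h.tableau_apply]
    have : π i < π k := h.lt_of_row_eq hπ (Fin.lt_def.2 (by omega)) hk.symm (by simp [hck])
    omega
  · intro j c hc hc'
    obtain ⟨i, rfl, rfl⟩ := (h.mem_iff j c).1 hc
    obtain ⟨k, hk, hck⟩ := (h.mem_iff _ _).1 hc'
    have hs := h.eq_succ hk (by simp [hck]) (by simp [hck]; ring)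
    rw [← hck, ← hk, h.tableau_apply, hk, h.tableau_apply]
    have h1 := (((h.cco_eq_iff π color).1 hπ).2 k i hs hk).not
    have h2 : ¬ π k < π i := h1.1 (by simp [hck])
    have h3 : π k ≠ π i := fun he => by
      have := π.injective he
      omega
    have h4 : (π k : ℕ) ≠ π i := fun he => h3 (Fin.ext he)
    rw [Fin.lt_def] at h2
    omega

theorem sDesTabSet_tableau (h : IsReading l color cell) {π : Equiv.Perm (Fin n)}
    (hπ : cco (cword π color) = l) :
    sDesTabSet (partiteShape l) n (tableau color cell π) =
      sDesPermSet π⁻¹ fun i => color (π⁻¹ i) := by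
  ext ⟨s, j⟩
  simp only [sDesTabSet, sDesPermSet, Set.mem_ofPred_eq]
  constructor
  · rintro ⟨_, c, hc, hs, rfl, hdes⟩
    obtain ⟨a, rfl, rfl⟩ := (h.mem_iff _ c).1 hc
    rw [h.tableau_apply] at hs
    have ha : ∀ hlt : s - 1 < n, π⁻¹ ⟨s - 1, hlt⟩ = a := fun hlt => by
      rw [Equiv.Perm.inv_eq_iff_eq]
      ext
      simp only
      omega
    rcases hdes with rfl | ⟨j', c', hc', hs', hdes⟩
    · exact Or.inr ⟨by omega, rfl, by rw [ha]⟩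
    · obtain ⟨b, rfl, rfl⟩ := (h.mem_iff _ c').1 hc'
      rw [h.tableau_apply] at hs'
      have hsn : s < n := by omega
      have hb : π⁻¹ ⟨s, hsn⟩ = b := by
        rw [Equiv.Perm.inv_eq_iff_eq]
        ext
        simp only
        omega
      refine Or.inl ⟨by omega, hsn, ?_, by rw [ha]⟩
      rw [ha, hb]
      by_cases hcol : color a = color b
      · refine Or.inr ⟨hcol, ?_⟩
        have hrow := hdes.resolve_left (not_not.2 hcol)
        by_contra hlt
        rcases (not_lt.1 hlt).lt_or_eq with hlt | heq
        · have := (h.bounds a b hlt hcol).1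
          omega
        · rw [Fin.ext heq] at hrow
          exact lt_irrefl _ hrow
      · exact Or.inl hcol
  · rintro (⟨h1, h2, hdes, hj⟩ | ⟨h0, rfl, hj⟩)
    · refine ⟨_, _, h.mem _, ?_, hj, Or.inr ⟨_, _, h.mem (π⁻¹ ⟨s, h2⟩), ?_, ?_⟩⟩
      · rw [h.tableau_apply, Equiv.Perm.coe_inv, Equiv.apply_symm_apply]
        simp only
        omega
      · rw [h.tableau_apply, Equiv.Perm.coe_inv, Equiv.apply_symm_apply]
      · rcases hdes with hcol | ⟨hcol, hlt⟩
        · exact Or.inl hcol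
        · right
          refine lt_of_le_of_ne (h.bounds _ _ hlt hcol.symm).1 fun hrow => ?_
          have := h.lt_of_row_eq hπ hlt hcol.symm hrow.symm
          rw [Equiv.Perm.coe_inv, Equiv.apply_symm_apply, Equiv.apply_symm_apply, Fin.lt_def] at this
          simp only at this
          omega
    · refine ⟨_, _, h.mem _, ?_, hj, Or.inl rfl⟩
      rw [h.tableau_apply, Equiv.Perm.coe_inv, Equiv.apply_symm_apply]
      simp only
      omega

theorem exists_tableau_eq (h : IsReading l color cell) {T : Fin r → ℤ × ℤ → ℕ}
    (hT : IsPartiteSYT (partiteShape l) n T) :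
    ∃ π : Equiv.Perm (Fin n), cco (cword π color) = l ∧ tableau color cell π = T := by
  obtain ⟨h0, hIcc, huniq, hrow, hcol⟩ := hT
  have hbd : ∀ i, 1 ≤ T (color i) (cell i) ∧ T (color i) (cell i) ≤ n := fun i =>
    Finset.mem_Icc.1 (hIcc _ _ (h.mem i))
  let g : Fin n → Fin n := fun i => ⟨T (color i) (cell i) - 1, by have := hbd i; omega⟩
  have hg : ∀ i, (g i : ℕ) + 1 = T (color i) (cell i) := fun i => Nat.sub_add_cancel (hbd i).1
  have hinj : Function.Injective g := by
    intro i k hik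
    have heq : T (color k) (cell k) = T (color i) (cell i) := by rw [← hg, ← hg, hik]
    exact h.injective ((huniq _ (hIcc _ _ (h.mem i))).unique
      (y₁ := (color i, cell i)) (y₂ := (color k, cell k)) ⟨h.mem i, rfl⟩ ⟨h.mem k, heq⟩)
  let π : Equiv.Perm (Fin n) := Equiv.ofBijective g (Finite.injective_iff_bijective.1 hinj)
  have hπ : ∀ i, (π i : ℕ) + 1 = T (color i) (cell i) := hg
  refine ⟨π, (h.cco_eq_iff π color).2 ⟨rfl, fun i k hik hc => ?_⟩, ?_⟩
  · have hi := hπ i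
    have hk := hπ k
    have hmi := h.mem i
    have hmk := h.mem k
    rw [← hc] at hk hmk
    rcases h.step i k hik hc with he | he
    · have := hrow (color i) (cell i) hmi (by rwa [← he])
      rw [← he] at this
      refine iff_of_true (by simp [he]) ?_
      rw [Fin.lt_def]
      omega
    · have hs : cell i = ((cell k).1 + 1, (cell k).2) := by rw [he]; ext <;> simp
      have := hcol (color i) (cell k) hmk (by rwa [← hs])
      rw [← hs] at this
      refine iff_of_false (by rw [he]; simp only; omega) ?_
      rw [Fin.lt_def]
      omega
  · funext j c
    by_cases hc : c ∈ partiteShape l j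
    · obtain ⟨i, rfl, rfl⟩ := (h.mem_iff j c).1 hc
      rw [h.tableau_apply, hπ]
    · rw [h.tableau_of_notMem π hc, h0 j c hc]

theorem tableau_injective (h : IsReading l color cell) :
    Function.Injective (tableau color cell) := by
  intro π σ hπσ
  ext i
  have := congrFun (congrFun hπσ (color i)) (cell i)
  rw [h.tableau_apply, h.tableau_apply] at this
  omega

end IsReading

/-- For every `r`-colored composition `(α,ε)` of `n` (given
as the list `l` of colored parts), there is a bijection from the colored
descent class `D_{(α,ε)}` to the set of standard Young `r`-partite tableaux of
shape `λ_{Z_{(α,ε)}}`, sending `(π, z)` to a tableau `Q` with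
`sDes(Q) = sDes((π,z)̄⁻¹)`.  In particular, the colored descent set is
equidistributed over the conjugate-inverse colored descent class
`D̄_{(α,ε)}⁻¹` and over `SYT(λ_{Z_{(α,ε)}})`. -/
theorem statement10 (n r : ℕ) (hn : 0 < n) [NeZero r] (l : List (ℕ × Fin r))
    (hpos : ∀ p ∈ l, 0 < p.1) (hsum : (l.map Prod.fst).sum = n) :
    (∃ f : {w : Equiv.Perm (Fin n) × (Fin n → Fin r) // cco (cword w.1 w.2) = l} →
          {T : Fin r → ℤ × ℤ → ℕ // IsPartiteSYT (partiteShape l) n T},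
        Function.Bijective f ∧
          ∀ w, sDesTabSet (partiteShape l) n (f w).1 =
            sDesPermSet (w.1.1⁻¹) (fun i => w.1.2 (w.1.1⁻¹ i))) ∧
      ∀ A : Set (ℕ × Fin r),
        {w : Equiv.Perm (Fin n) × (Fin n → Fin r) |
            cco (cword w.1⁻¹ fun i => w.2 (w.1⁻¹ i)) = l ∧
            sDesPermSet w.1 w.2 = A}.ncard =
          {T : Fin r → ℤ × ℤ → ℕ |
            IsPartiteSYT (partiteShape l) n T ∧
            sDesTabSet (partiteShape l) n T = A}.ncard := by
  obtain ⟨color, cell, h⟩ := exists_isReading l hpos hsum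
  have hz : ∀ {π : Equiv.Perm (Fin n)} {z : Fin n → Fin r}, cco (cword π z) = l → z = color :=
    fun {π z} hw => ((h.cco_eq_iff π z).1 hw).1
  have hcolor : ∀ {π : Equiv.Perm (Fin n)} {z : Fin n → Fin r}, cco (cword π z) = l →
      cco (cword π color) = l := fun hw => hz hw ▸ hw
  constructor
  · refine ⟨fun w => ⟨IsReading.tableau color cell w.1.1, h.isPartiteSYT_tableau (hcolor w.2)⟩,
      ⟨?_, ?_⟩, ?_⟩
    · intro w w' hww'
      have h1 := h.tableau_injective (Subtype.ext_iff.1 hww')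
      exact Subtype.ext (Prod.ext h1 ((hz w.2).trans (hz w'.2).symm))
    · intro T
      obtain ⟨π, hπ, hT⟩ := h.exists_tableau_eq T.2
      exact ⟨⟨(π, color), hπ⟩, Subtype.ext hT⟩
    · intro w
      rw [hz w.2]
      exact h.sDesTabSet_tableau (hcolor w.2)
  · intro A
    have hrecover : ∀ w : Equiv.Perm (Fin n) × (Fin n → Fin r),
        (fun i => w.2 (w.1⁻¹ i)) = color → w.2 = fun i => color (w.1 i) := by
      intro w hw
      funext i
      rw [← hw]
      simp
    have hdes : ∀ w : Equiv.Perm (Fin n) × (Fin n → Fin r),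
        cco (cword w.1⁻¹ fun i => w.2 (w.1⁻¹ i)) = l →
        sDesTabSet (partiteShape l) n (IsReading.tableau color cell w.1⁻¹) =
          sDesPermSet w.1 w.2 := by
      intro w hw
      rw [h.sDesTabSet_tableau (hcolor hw), inv_inv, ← hrecover w (hz hw)]
    refine Set.ncard_congr (fun w _ => IsReading.tableau color cell w.1⁻¹) ?_ ?_ ?_
    · rintro w ⟨hw, hA⟩
      exact ⟨h.isPartiteSYT_tableau (hcolor hw), (hdes w hw).trans hA⟩
    · rintro w w' ⟨hw, -⟩ ⟨hw', -⟩ hww'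
      have h1 : w.1 = w'.1 := inv_injective (h.tableau_injective hww')
      refine Prod.ext h1 ?_
      rw [hrecover w (hz hw), hrecover w' (hz hw'), h1]
    · rintro T ⟨hT, hA⟩
      obtain ⟨π, hπ, rfl⟩ := h.exists_tableau_eq hT
      have hw : cco (cword π⁻¹⁻¹ fun i => color (π⁻¹ (π⁻¹⁻¹ i))) = l := by simpa using hπ
      exact ⟨(π⁻¹, fun i => color (π⁻¹ i)),
        ⟨hw, by rw [← hdes _ hw, inv_inv]; exact hA⟩, by rw [inv_inv]⟩
end

section
/- For every r-partite partition 𝛌 of n, the colored Schur function s_𝛌 satisfies s_𝛌 = Σ_{Q ∈ SYT(𝛌)} F^{(r)}_{co(Q)}, where the sum is over all standard Young r-partite tableaux of shape 𝛌 and co(Q) is the colored descent composition of Q. -/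
/-- The extended color vector of a colored composition: each color is repeated
as many times as the size of its part. -/
def colorWord {r : ℕ} (l : List (ℕ × Fin r)) : List (Fin r) :=
  (l.map fun p => List.replicate p.1 p.2).flatten

/-- Poirier's colored fundamental quasisymmetric function `F^{(r)}_{(α,ε)}`
associated with the colored composition `l` of `n`, in the `r` sets of
variables `x^{(j)}_i` indexed by `Fin r × ℕ`: the sum over all weakly
increasing `i₁ ≤ … ≤ i_n` which increase strictly at every partial sum
`r_j = α₁ + … + α_j` with `ε_j ≥ ε_{j+1}`, of
`x^{(ε̃₁)}_{i_1} ⋯ x^{(ε̃_n)}_{i_n}` where `ε̃` is the extended color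
vector. -/
noncomputable def Fcol {r : ℕ} [NeZero r] (n : ℕ) (l : List (ℕ × Fin r)) :
    MvPowerSeries (Fin r × ℕ) ℤ := fun d =>
  (({i : Fin n → ℕ |
      Monotone i ∧
      (∀ k, k + 1 < l.length → (l.getD (k + 1) (1, 0)).2 ≤ (l.getD k (1, 0)).2 →
        ∀ (h1 : 1 ≤ ((l.take (k + 1)).map Prod.fst).sum)
          (h2 : ((l.take (k + 1)).map Prod.fst).sum < n),
          i ⟨((l.take (k + 1)).map Prod.fst).sum - 1, by omega⟩ <
            i ⟨((l.take (k + 1)).map Prod.fst).sum, h2⟩) ∧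
      (∑ t : Fin n, Finsupp.single ((colorWord l).getD (t : ℕ) 0, i t) 1) = d}).ncard : ℤ)
/-- The (skew) Schur function of the shape with cell set `D`, in the variables
`x^{(j)}_i` of color `j` (inside the ring of power series in all `r` sets of
variables): the generating function of semistandard fillings of `D`. -/
noncomputable def skewSchurIn {r : ℕ} (j : Fin r) (D : Finset (ℤ × ℤ)) :
    MvPowerSeries (Fin r × ℕ) ℤ := fun d =>
  (({T : ℤ × ℤ → ℕ |
      (∀ c ∉ D, T c = 0) ∧
      (∀ c ∈ D, (c.1, c.2 + 1) ∈ D → T c ≤ T (c.1, c.2 + 1)) ∧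
      (∀ c ∈ D, (c.1 + 1, c.2) ∈ D → T c < T (c.1 + 1, c.2)) ∧
      (∑ c ∈ D, Finsupp.single (j, T c) 1) = d}).ncard : ℤ)
open Classical in
/-- The color of the part of the `r`-partite tableau `T` containing the entry
`m` (and `0` if there is no such part). -/
noncomputable def tabColor {r : ℕ} [NeZero r] (sh : Fin r → Finset (ℤ × ℤ))
    (T : Fin r → ℤ × ℤ → ℕ) (m : ℕ) : Fin r :=
  if h : ∃ p : Fin r × (ℤ × ℤ), p.2 ∈ sh p.1 ∧ T p.1 p.2 = m then
    (Classical.choose h).1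
  else 0

open Classical in
/-- The set `S⁺ = S ∪ {n}` underlying the colored descent set of an
`r`-partite tableau `T` with entries `1, …, n`. -/
noncomputable def sDesPlusTab {r : ℕ} (sh : Fin r → Finset (ℤ × ℤ)) (n : ℕ)
    (T : Fin r → ℤ × ℤ → ℕ) : Finset ℕ :=
  (Finset.Icc 1 n).filter fun i =>
    i = n ∨ ∃ j, ∃ c ∈ sh j, ∃ j', ∃ c' ∈ sh j',
      T j c = i ∧ T j' c' = i + 1 ∧ (j ≠ j' ∨ c.1 < c'.1)

/-- The colored descent composition `co(Q)` of an `r`-partite tableau: the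
colored composition whose parts are the successive differences of the elements
of `S⁺ = sDes(Q) ∪ {n}` and whose colors are the colors of the parts containing
those entries. -/
noncomputable def coTab {r : ℕ} [NeZero r] (sh : Fin r → Finset (ℤ × ℤ))
    (n : ℕ) (T : Fin r → ℤ × ℤ → ℕ) : List (ℕ × Fin r) :=
  let L := (sDesPlusTab sh n T).sort (· ≤ ·)
  (List.range L.length).map fun k =>
    (L.getD k 0 - (if k = 0 then 0 else L.getD (k - 1) 0),
      tabColor sh T (L.getD k 0))

/-- The `r`-partite shape (in `ℤ × ℤ` cells) of an `r`-partite partition,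
given as a tuple of Young diagrams. -/
def shOf {r : ℕ} (lam : Fin r → YoungDiagram) : Fin r → Finset (ℤ × ℤ) :=
  fun j => (lam j).cells.image fun c => ((c.1 : ℤ), (c.2 : ℤ))

/-- The colored composition with partial sums `L` (measured from `p`), the part ending at `a`
having color `col a`. -/
def diffComp {α : Type*} (col : ℕ → α) : ℕ → List ℕ → List (ℕ × α)
  | _, [] => []
  | p, a :: L => (a - p, col a) :: diffComp col a L

@[simp]
theorem length_diffComp {α : Type*} (col : ℕ → α) (p : ℕ) (L : List ℕ) :
    (diffComp col p L).length = L.length := by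
  induction L generalizing p with
  | nil => rfl
  | cons a L ih => simp [diffComp, ih]

theorem getElem_diffComp {α : Type*} (col : ℕ → α) (p : ℕ) (L : List ℕ) (k : ℕ)
    (hk : k < L.length) :
    (diffComp col p L)[k]'(by simpa using hk) =
      (L[k] - (if k = 0 then p else L.getD (k - 1) 0), col L[k]) := by
  induction L generalizing p k with
  | nil => simp at hk
  | cons a L ih =>
    cases k with
    | zero => simp [diffComp]
    | succ k =>
      have hk' : k < L.length := by simpa using hk
      simp only [diffComp, List.getElem_cons_succ, ih a k hk']
      cases k <;> simp

theorem sum_take_diffComp {α : Type*} (col : ℕ → α) (p : ℕ) (L : List ℕ)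
    (hL : (p :: L).SortedLT) (k : ℕ) (hk : k < L.length) :
    (((diffComp col p L).take (k + 1)).map Prod.fst).sum = L[k] - p := by
  induction L generalizing p k with
  | nil => simp at hk
  | cons a L ih =>
    have h1 := hL.pairwise
    rw [List.pairwise_cons] at h1
    have hpa : p < a := h1.1 a (by simp)
    cases k with
    | zero => simp [diffComp]
    | succ k =>
      have hk' : k < L.length := by simpa using hk
      have h2 := h1.2
      rw [List.pairwise_cons] at h2
      have := h2.1 _ (List.getElem_mem hk')
      simp only [diffComp, List.take_succ_cons, List.map_cons, List.sum_cons,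
        ih a h1.2.sortedLT k hk', List.getElem_cons_succ]
      omega

theorem getD_colorWord_diffComp {r : ℕ} [NeZero r] (col : ℕ → Fin r) (p : ℕ) (L : List ℕ)
    (hL : (p :: L).SortedLT)
    (hcol : ∀ m, p < m → m ∉ L → (∃ x ∈ L, m < x) → col m = col (m + 1))
    (t : ℕ) (ht : ∃ x ∈ L, p + t < x) :
    (colorWord (diffComp col p L)).getD t 0 = col (p + t + 1) := by
  induction L generalizing p t with
  | nil => simp at ht
  | cons a L ih =>
    have h1 := hL.pairwise
    rw [List.pairwise_cons] at h1
    have hpa : p < a := h1.1 a (by simp)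
    have h2 := h1.2
    rw [List.pairwise_cons] at h2
    have hcw : colorWord (diffComp col p (a :: L)) =
        List.replicate (a - p) (col a) ++ colorWord (diffComp col a L) := by
      simp [colorWord, diffComp]
    rw [hcw]
    by_cases hta : p + t < a
    · rw [List.getD_append _ _ _ _ (by simp; omega), List.getD_replicate _ (by omega)]
      have key : ∀ j, ∀ m, p < m → m + j = a → col m = col a := by
        intro j
        induction j with
        | zero => intro m _ h; rw [← h, add_zero]
        | succ j ihj =>
          intro m hm h
          rw [hcol m hm _ ⟨a, by simp, by omega⟩]
          · exact ihj (m + 1) (by omega) (by omega)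
          · intro hmem
            rcases List.mem_cons.1 hmem with h' | h'
            · omega
            · have := h2.1 m h'
              omega
      exact (key (a - (p + t + 1)) (p + t + 1) (by omega) (by omega)).symm
    · rw [List.getD_append_right _ _ _ _ (by simp; omega), List.length_replicate, ih a h1.2.sortedLT]
      · congr 1
        omega
      · intro m hm hmL hx
        refine hcol m (by omega) ?_ ?_
        · simp only [List.mem_cons, not_or]
          exact ⟨by omega, hmL⟩
        · obtain ⟨x, hx, hmx⟩ := hx
          exact ⟨x, by simp [hx], hmx⟩
      · obtain ⟨x, hx, hmx⟩ := ht
        rcases List.mem_cons.1 hx with h' | h'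
        · omega
        · exact ⟨x, h', by omega⟩

theorem coTab_eq_diffComp {r : ℕ} [NeZero r] (sh : Fin r → Finset (ℤ × ℤ)) (n : ℕ)
    (Q : Fin r → ℤ × ℤ → ℕ) :
    coTab sh n Q = diffComp (tabColor sh Q) 0 ((sDesPlusTab sh n Q).sort (· ≤ ·)) := by
  apply List.ext_getElem
  · simp [coTab]
  · intro k h1 h2
    have hk : k < ((sDesPlusTab sh n Q).sort (· ≤ ·)).length := by simpa using h2
    rw [getElem_diffComp _ _ _ _ hk]
    simp only [coTab, List.getElem_map, List.getElem_range, List.getD_eq_getElem _ _ hk]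

/-- If `f j` is the generating function of the family `X j` by weight, then `∏ j, f j` is the
generating function of the tuples with entries in the `X j` by total weight. -/
theorem coeff_prod_ncard {r : ℕ} {α σ : Type*} (X : Fin r → Set α) (w : Fin r → α → σ →₀ ℕ)
    (hfin : ∀ j e, {T | T ∈ X j ∧ w j T = e}.Finite) (f : Fin r → MvPowerSeries σ ℤ)
    (hf : ∀ j e, MvPowerSeries.coeff e (f j) = ({T | T ∈ X j ∧ w j T = e}.ncard : ℤ))
    (d : σ →₀ ℕ) :
    {T : Fin r → α | (∀ j, T j ∈ X j) ∧ ∑ j, w j (T j) = d}.Finite ∧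
    MvPowerSeries.coeff d (∏ j, f j) =
      ({T : Fin r → α | (∀ j, T j ∈ X j) ∧ ∑ j, w j (T j) = d}.ncard : ℤ) := by
  classical
  have hset : {T : Fin r → α | (∀ j, T j ∈ X j) ∧ ∑ j, w j (T j) = d} =
      ((Finset.univ.finsuppAntidiag d).biUnion fun l : Fin r →₀ (σ →₀ ℕ) =>
        Fintype.piFinset fun j => (hfin j (l j)).toFinset : Finset (Fin r → α)) := by
    ext T
    simp only [Set.mem_ofPred_eq, Finset.coe_biUnion, Finset.mem_coe, Set.mem_iUnion,
      Fintype.mem_piFinset, Set.Finite.mem_toFinset, Finset.mem_finsuppAntidiag, exists_prop]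
    constructor
    · rintro ⟨h1, h2⟩
      exact ⟨Finsupp.equivFunOnFinite.symm fun j => w j (T j), ⟨by simpa using h2, by simp⟩,
        fun j => ⟨h1 j, by simp⟩⟩
    · rintro ⟨l, ⟨h1, -⟩, h2⟩
      refine ⟨fun j => (h2 j).1, ?_⟩
      rw [← h1]
      exact Finset.sum_congr rfl fun j _ => (h2 j).2
  rw [hset]
  refine ⟨Finset.finite_toSet _, ?_⟩
  rw [Set.ncard_coe_finset, Finset.card_biUnion, MvPowerSeries.coeff_prod]
  · push_cast
    refine Finset.sum_congr rfl fun l _ => ?_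
    rw [Fintype.card_piFinset]
    push_cast
    refine Finset.prod_congr rfl fun j _ => ?_
    rw [hf, Set.ncard_eq_toFinset_card _ (hfin j (l j))]
  · intro l _ l' _ hne
    refine Finset.disjoint_left.2 fun T hT hT' => hne ?_
    simp only [Fintype.mem_piFinset, Set.Finite.mem_toFinset, Set.mem_ofPred_eq] at hT hT'
    ext1 j
    rw [← (hT j).2, ← (hT' j).2]

theorem finite_bounded_fillings (D : Finset (ℤ × ℤ)) (N : ℕ) :
    {T : ℤ × ℤ → ℕ | (∀ c ∉ D, T c = 0) ∧ ∀ c ∈ D, T c ≤ N}.Finite := by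
  classical
  refine Set.Finite.of_finite_image (f := fun T => fun c : D => T c) ?_ ?_
  · refine (Fintype.piFinset fun _ : D => Finset.Iic N).finite_toSet.subset ?_
    rintro _ ⟨T, hT, rfl⟩
    exact Finset.mem_coe.2 (Fintype.mem_piFinset.2 fun c => Finset.mem_Iic.2 (hT.2 c c.2))
  · intro T hT T' hT' h
    ext c
    by_cases hc : c ∈ D
    · exact congrFun h ⟨c, hc⟩
    · rw [hT.1 c hc, hT'.1 c hc]

theorem finite_fillings_of_weight {r : ℕ} (j : Fin r) (D : Finset (ℤ × ℤ))
    (d : Fin r × ℕ →₀ ℕ) :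
    {T : ℤ × ℤ → ℕ | (∀ c ∉ D, T c = 0) ∧ ∑ c ∈ D, Finsupp.single (j, T c) 1 = d}.Finite := by
  refine (finite_bounded_fillings D (d.support.sup Prod.snd)).subset ?_
  rintro T ⟨h0, hd⟩
  refine ⟨h0, fun c hc => ?_⟩
  refine Finset.le_sup (f := Prod.snd) (b := (j, T c)) ?_
  have h1 := Finset.single_le_sum (f := fun c => Finsupp.single (j, T c) 1)
    (fun i _ => zero_le) hc
  rw [hd] at h1
  have h2 := h1 (j, T c)
  simp at h2
  simp
  omega

theorem forall_diffComp_iff {r n : ℕ} [NeZero r] (S : Finset ℕ) (hS : S ⊆ Finset.Icc 1 n)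
    (hn : n ∈ S) (col : ℕ → Fin r)
    (hcol : ∀ m, 1 ≤ m → m < n → m ∉ S → col m = col (m + 1)) (P : ℕ → Prop) :
    (∀ k, k + 1 < (diffComp col 0 (S.sort (· ≤ ·))).length →
      ((diffComp col 0 (S.sort (· ≤ ·))).getD (k + 1) (1, 0)).2 ≤
        ((diffComp col 0 (S.sort (· ≤ ·))).getD k (1, 0)).2 →
      P ((((diffComp col 0 (S.sort (· ≤ ·))).take (k + 1)).map Prod.fst).sum)) ↔
    ∀ m ∈ S, m < n → col (m + 1) ≤ col m → P m := by
  have hmem : ∀ x, x ∈ S.sort (· ≤ ·) ↔ x ∈ S := fun x => Finset.mem_sort (· ≤ ·)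
  have hsort : (S.sort (· ≤ ·)).SortedLT := Finset.sortedLT_sort S
  generalize S.sort (· ≤ ·) = L at hmem hsort
  have hL0 : (0 :: L).SortedLT := by
    refine List.Pairwise.sortedLT (List.pairwise_cons.2 ⟨fun a ha => ?_, hsort.pairwise⟩)
    exact (Finset.mem_Icc.1 (hS ((hmem a).1 ha))).1
  have hmono : ∀ a b (ha : a < L.length) (hb : b < L.length), a < b → L[a] < L[b] :=
    fun a b ha hb hab => List.pairwise_iff_getElem.1 hsort.pairwise a b ha hb hab
  have hle : ∀ x ∈ L, 1 ≤ x ∧ x ≤ n := fun x hx => Finset.mem_Icc.1 (hS ((hmem x).1 hx))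
  have hnext : ∀ k (hk : k + 1 < L.length), col L[k + 1] = col (L[k] + 1) := by
    intro k hk
    have key : ∀ j m, L[k] < m → m + j = L[k + 1] → col m = col L[k + 1] := by
      intro j
      induction j with
      | zero => intro m _ h; rw [← h, add_zero]
      | succ j ihj =>
        intro m hm h
        have h1 := hle _ (List.getElem_mem hk)
        rw [hcol m (by omega) (by omega), ihj (m + 1) (by omega) (by omega)]
        intro hmS
        obtain ⟨a, ha, rfl⟩ := List.getElem_of_mem ((hmem m).2 hmS)
        rcases lt_trichotomy a k with h' | h' | h'
        · have := hmono a k ha (by omega) h'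
          omega
        · subst h'
          omega
        · rcases eq_or_lt_of_le (show k + 1 ≤ a from h') with h'' | h''
          · subst h''
            omega
          · have := hmono (k + 1) a hk ha h''
            omega
    have := hmono k (k + 1) (by omega) hk (by omega)
    exact (key (L[k + 1] - (L[k] + 1)) (L[k] + 1) (by omega) (by omega)).symm
  have hget : ∀ k (hk : k < L.length), ((diffComp col 0 L).getD k (1, 0)).2 = col L[k] := by
    intro k hk
    rw [List.getD_eq_getElem _ _ (by simpa using hk), getElem_diffComp _ _ _ _ hk]
  constructor
  · intro h m hmS hmn hc
    obtain ⟨k, hk, rfl⟩ := List.getElem_of_mem ((hmem m).2 hmS)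
    obtain ⟨k', hk', hkn⟩ := List.getElem_of_mem ((hmem n).2 hn)
    have hkk : k + 1 < L.length := by
      by_contra hcon
      rcases lt_or_eq_of_le (show k' ≤ k by omega) with h' | h'
      · have := hmono k' k hk' hk h'
        omega
      · subst h'
        omega
    have := h k (by simpa using hkk)
    rw [hget _ hkk, hget _ hk, hnext k hkk, sum_take_diffComp col 0 L hL0 k hk] at this
    exact this hc
  · intro h k hk hc
    have hk' : k + 1 < L.length := by simpa using hk
    have hk0 : k < L.length := by omega
    rw [hget _ hk', hget _ hk0, hnext k hk'] at hc
    rw [sum_take_diffComp col 0 L hL0 k hk0]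
    have := hmono k (k + 1) hk0 hk' (by omega)
    have := hle _ (List.getElem_mem hk')
    exact h _ ((hmem _).1 (List.getElem_mem hk0)) (by omega) hc

/-- The cells of an `r`-partite shape, tagged with their colors. -/
def coloredCells {r : ℕ} (sh : Fin r → Finset (ℤ × ℤ)) : Finset (Fin r × ℤ × ℤ) :=
  Finset.univ.biUnion fun j => (sh j).image (Prod.mk j)

@[simp]
theorem mem_coloredCells {r : ℕ} {sh : Fin r → Finset (ℤ × ℤ)} {p : Fin r × ℤ × ℤ} :
    p ∈ coloredCells sh ↔ p.2 ∈ sh p.1 := by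
  obtain ⟨j, c⟩ := p
  simp [coloredCells]

theorem sum_coloredCells {r : ℕ} {M : Type*} [AddCommMonoid M] (sh : Fin r → Finset (ℤ × ℤ))
    (f : Fin r × ℤ × ℤ → M) :
    ∑ p ∈ coloredCells sh, f p = ∑ j, ∑ c ∈ sh j, f (j, c) :=
  Finset.sum_finset_product _ _ _ fun p => by simp

theorem card_coloredCells {r : ℕ} (sh : Fin r → Finset (ℤ × ℤ)) :
    (coloredCells sh).card = ∑ j, (sh j).card := by
  simp only [Finset.card_eq_sum_ones, sum_coloredCells]

/-- The semistandard fillings of a shape. -/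
def semistandardFillings (D : Finset (ℤ × ℤ)) : Set (ℤ × ℤ → ℕ) :=
  {T | (∀ c ∉ D, T c = 0) ∧
    (∀ c ∈ D, (c.1, c.2 + 1) ∈ D → T c ≤ T (c.1, c.2 + 1)) ∧
    (∀ c ∈ D, (c.1 + 1, c.2) ∈ D → T c < T (c.1 + 1, c.2))}

/-- The key by which the cells of a semistandard filling are ordered during standardization:
first by value, then by color, then from bottom to top and from left to right. -/
def cellKey {r : ℕ} (v : ℕ) (p : Fin r × ℤ × ℤ) : ℕ ×ₗ Fin r ×ₗ ℤ ×ₗ ℤ :=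
  toLex (v, toLex (p.1, toLex (-p.2.1, p.2.2)))

theorem cellKey_lt_iff {r v w : ℕ} {p q : Fin r × ℤ × ℤ} :
    cellKey v p < cellKey w q ↔ v < w ∨ v = w ∧ (p.1 < q.1 ∨ p.1 = q.1 ∧
      (q.2.1 < p.2.1 ∨ p.2.1 = q.2.1 ∧ p.2.2 < q.2.2)) := by
  simp [cellKey, Prod.Lex.toLex_lt_toLex]

theorem cellKey_injective {r v w : ℕ} {p q : Fin r × ℤ × ℤ} (h : cellKey v p = cellKey w q) :
    p = q := by
  simp only [cellKey, EmbeddingLike.apply_eq_iff_eq, Prod.mk.injEq, neg_inj] at h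
  exact Prod.ext h.2.1 (Prod.ext h.2.2.1 h.2.2.2)

/-- `pos` lists the cells of the standard tableau `Q` in the order of their entries. -/
def IsReading_s11 {r : ℕ} (sh : Fin r → Finset (ℤ × ℤ)) (n : ℕ) (Q : Fin r → ℤ × ℤ → ℕ)
    (pos : ℕ → Fin r × ℤ × ℤ) : Prop :=
  (∀ m, 1 ≤ m → m ≤ n → pos m ∈ coloredCells sh ∧ Q (pos m).1 (pos m).2 = m) ∧
  ∀ p ∈ coloredCells sh, 1 ≤ Q p.1 p.2 ∧ Q p.1 p.2 ≤ n ∧ pos (Q p.1 p.2) = p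

section

variable {r : ℕ} {sh : Fin r → Finset (ℤ × ℤ)} {n : ℕ} {Q : Fin r → ℤ × ℤ → ℕ}
  {pos : ℕ → Fin r × ℤ × ℤ}

theorem IsPartiteSYT.exists_isReading [NeZero r] (hQ : IsPartiteSYT sh n Q) :
    ∃ pos, IsReading_s11 sh n Q pos := by
  have h : ∀ m, ∃ p : Fin r × ℤ × ℤ, 1 ≤ m → m ≤ n → p.2 ∈ sh p.1 ∧ Q p.1 p.2 = m := by
    intro m
    by_cases hm : m ∈ Finset.Icc 1 n
    · obtain ⟨p, hp, -⟩ := hQ.2.2.1 m hm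
      exact ⟨p, fun _ _ => hp⟩
    · exact ⟨(0, 0), fun h1 h2 => absurd (Finset.mem_Icc.2 ⟨h1, h2⟩) hm⟩
  choose pos hpos using h
  refine ⟨pos, fun m h1 h2 => ?_, fun p hp => ?_⟩
  · simpa using hpos m h1 h2
  · rw [mem_coloredCells] at hp
    have h1 := hQ.2.1 _ _ hp
    have h2 := Finset.mem_Icc.1 h1
    exact ⟨h2.1, h2.2, (hQ.2.2.1 _ h1).unique (hpos _ h2.1 h2.2) ⟨hp, rfl⟩⟩

theorem IsReading_s11.tabColor_eq [NeZero r] (hpos : IsReading_s11 sh n Q pos) {m : ℕ} (h1 : 1 ≤ m)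
    (h2 : m ≤ n) : tabColor sh Q m = (pos m).1 := by
  have h : ∃ p : Fin r × (ℤ × ℤ), p.2 ∈ sh p.1 ∧ Q p.1 p.2 = m :=
    ⟨pos m, by simpa using hpos.1 m h1 h2⟩
  rw [tabColor, dif_pos h]
  have h3 := hpos.2 _ (mem_coloredCells.2 h.choose_spec.1)
  rw [h.choose_spec.2] at h3
  rw [h3.2.2]

theorem IsReading_s11.mem_sDesPlusTab_iff (hpos : IsReading_s11 sh n Q pos) {m : ℕ} (h1 : 1 ≤ m)
    (h2 : m < n) : m ∈ sDesPlusTab sh n Q ↔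
      (pos m).1 ≠ (pos (m + 1)).1 ∨ (pos m).2.1 < (pos (m + 1)).2.1 := by
  rw [sDesPlusTab, Finset.mem_filter, Finset.mem_Icc]
  constructor
  · rintro ⟨-, h | ⟨j, c, hc, j', c', hc', hm, hm', h⟩⟩
    · omega
    · have e := (hpos.2 (j, c) (by simpa using hc)).2.2
      have e' := (hpos.2 (j', c') (by simpa using hc')).2.2
      simp only [hm, hm'] at e e'
      rw [e, e']
      exact h
  · intro h
    have a := hpos.1 m h1 h2.le
    have b := hpos.1 (m + 1) (by omega) h2
    rw [mem_coloredCells] at a b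
    exact ⟨⟨h1, h2.le⟩, Or.inr ⟨_, _, a.1, _, _, b.1, a.2, b.2, h⟩⟩

/-- The rows of every part of an `r`-partite shape are intervals. -/
def RowConvex (sh : Fin r → Finset (ℤ × ℤ)) : Prop :=
  ∀ j a b b' x, (a, b) ∈ sh j → (a, b') ∈ sh j → b ≤ x → x ≤ b' → (a, x) ∈ sh j

theorem IsPartiteSYT.lt_of_row (hQ : IsPartiteSYT sh n Q) (hsh : RowConvex sh) {j : Fin r}
    {a b b' : ℤ} (hb : (a, b) ∈ sh j) (hb' : (a, b') ∈ sh j) (h : b < b') :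
    Q j (a, b) < Q j (a, b') := by
  have key : ∀ x, b + 1 ≤ x → x ≤ b' → Q j (a, b) < Q j (a, x) := by
    intro x hx
    induction x, hx using Int.leInduction with
    | base =>
      intro hle
      exact hQ.2.2.2.1 j (a, b) hb (hsh j a b b' _ hb hb' (by omega) hle)
    | succ x hx ih =>
      intro hle
      exact (ih (by omega)).trans (hQ.2.2.2.1 j (a, x) (hsh j a b b' _ hb hb' (by omega) (by omega))
        (hsh j a b b' _ hb hb' (by omega) hle))
  exact key b' h le_rfl

/-- The sequences compatible with the colored descents of the tableau read by `pos`. -/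
def CompatibleSeq {n : ℕ} (pos : ℕ → Fin r × ℤ × ℤ) (i : Fin n → ℕ) : Prop :=
  ∀ t (h : t + 1 < n), cellKey (i ⟨t, by omega⟩) (pos (t + 1)) <
    cellKey (i ⟨t + 1, h⟩) (pos (t + 2))

theorem compatibleSeq_iff (hQ : IsPartiteSYT sh n Q) (hsh : RowConvex sh)
    (hpos : IsReading_s11 sh n Q pos) (i : Fin n → ℕ) :
    CompatibleSeq pos i ↔ Monotone i ∧ ∀ m ∈ sDesPlusTab sh n Q, m < n →
      (pos (m + 1)).1 ≤ (pos m).1 → ∀ (_ : 1 ≤ m) (h2 : m < n),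
        i ⟨m - 1, by omega⟩ < i ⟨m, h2⟩ := by
  constructor
  · intro h
    refine ⟨?_, ?_⟩
    · have key : ∀ a b (hab : a ≤ b) (hb : b < n), i ⟨a, by omega⟩ ≤ i ⟨b, hb⟩ := by
        intro a b hab
        induction b, hab using Nat.le_induction with
        | base => intro _; rfl
        | succ b hab ih =>
          intro hb
          refine (ih (by omega)).trans ?_
          rcases cellKey_lt_iff.1 (h b hb) with h' | h'
          · exact h'.le
          · exact h'.1.le
      exact fun a b hab => key a b hab b.2
    · intro m hm _ hc h1 h2
      obtain ⟨t, rfl⟩ : ∃ t, m = t + 1 := ⟨m - 1, by omega⟩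
      rw [hpos.mem_sDesPlusTab_iff h1 h2] at hm
      rcases cellKey_lt_iff.1 (h t h2) with h' | ⟨-, h' | ⟨h', h''⟩⟩
      · exact h'
      · exact absurd hc (not_le.2 h')
      · rcases hm with hm | hm
        · exact absurd h' hm
        · rw [show t + 1 + 1 = t + 2 from rfl] at hm
          omega
  · rintro ⟨hmono, hdes⟩ t ht
    rw [cellKey_lt_iff]
    rcases lt_or_eq_of_le (hmono (show (⟨t, by omega⟩ : Fin n) ≤ ⟨t + 1, ht⟩ by simp)) with h | h
    · exact Or.inl h
    · refine Or.inr ⟨h, ?_⟩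
      by_cases hm : t + 1 ∈ sDesPlusTab sh n Q
      · refine Or.inl (not_le.1 fun hc => ?_)
        exact absurd h (hdes _ hm ht hc (by omega) ht).ne
      · rw [hpos.mem_sDesPlusTab_iff (by omega) ht] at hm
        push Not at hm
        obtain ⟨h1, h2⟩ := hm
        refine Or.inr ⟨h1, (lt_or_eq_of_le h2).imp id fun h3 => ⟨h3.symm, not_le.1 fun h4 => ?_⟩⟩
        have ha := hpos.1 (t + 1) (by omega) (by omega)
        have hb := hpos.1 (t + 2) (by omega) (by omega)
        rw [show t + 1 + 1 = t + 2 from rfl] at *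
        rw [mem_coloredCells] at ha hb
        clear hdes hpos
        generalize pos (t + 1) = p at *
        generalize pos (t + 2) = q at *
        obtain ⟨j, a, b⟩ := p
        obtain ⟨j', a', b'⟩ := q
        dsimp only at *
        subst h1 h3
        rcases lt_or_eq_of_le h4 with h5 | h5
        · have := hQ.lt_of_row hsh hb.1 ha.1 h5
          omega
        · subst h5
          omega

theorem coeff_Fcol_coTab [NeZero r] (hn : 0 < n) (hQ : IsPartiteSYT sh n Q) (hsh : RowConvex sh)
    (hpos : IsReading_s11 sh n Q pos) (d : Fin r × ℕ →₀ ℕ) :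
    MvPowerSeries.coeff d (Fcol n (coTab sh n Q)) =
      ({i : Fin n → ℕ | CompatibleSeq pos i ∧
        ∑ t : Fin n, Finsupp.single ((pos (t + 1)).1, i t) 1 = d}.ncard : ℤ) := by
  have hS : sDesPlusTab sh n Q ⊆ Finset.Icc 1 n := Finset.filter_subset _ _
  have hnS : n ∈ sDesPlusTab sh n Q := by
    rw [sDesPlusTab, Finset.mem_filter]
    exact ⟨Finset.mem_Icc.2 ⟨hn, le_rfl⟩, Or.inl rfl⟩
  have hcol : ∀ m, 1 ≤ m → m < n → m ∉ sDesPlusTab sh n Q →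
      tabColor sh Q m = tabColor sh Q (m + 1) := by
    intro m h1 h2 h
    rw [hpos.mem_sDesPlusTab_iff h1 h2] at h
    push Not at h
    rw [hpos.tabColor_eq h1 h2.le, hpos.tabColor_eq (by omega) h2, h.1]
  have hword : ∀ t : Fin n,
      (colorWord (coTab sh n Q)).getD (t : ℕ) 0 = (pos (t + 1)).1 := by
    intro t
    rw [coTab_eq_diffComp, getD_colorWord_diffComp, zero_add, hpos.tabColor_eq (by omega) t.2]
    · refine List.Pairwise.sortedLT (List.pairwise_cons.2
        ⟨fun a ha => ?_, (Finset.sortedLT_sort _).pairwise⟩)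
      exact (Finset.mem_Icc.1 (hS ((Finset.mem_sort _).1 ha))).1
    · rintro m hm hmS ⟨x, hx, hmx⟩
      have := Finset.mem_Icc.1 (hS ((Finset.mem_sort _).1 hx))
      exact hcol m hm (by omega) fun h => hmS ((Finset.mem_sort _).2 h)
    · exact ⟨n, (Finset.mem_sort _).2 hnS, by omega⟩
  change ((Set.ncard _ : ℕ) : ℤ) = _
  congr 2
  ext i
  simp only [Set.mem_ofPred_eq, hword]
  rw [← and_assoc, and_congr_left_iff]
  intro _
  rw [compatibleSeq_iff hQ hsh hpos, coTab_eq_diffComp]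
  refine and_congr_right fun _ => ?_
  rw [forall_diffComp_iff _ hS hnS _ hcol
    (fun m => ∀ (_ : 1 ≤ m) (h2 : m < n), i ⟨m - 1, by omega⟩ < i ⟨m, h2⟩)]
  refine forall₃_congr fun m hm hmn => ?_
  rw [hpos.tabColor_eq (Finset.mem_Icc.1 (hS hm)).1 hmn.le, hpos.tabColor_eq (by omega) hmn]

/-- The standardization of an `r`-tuple of fillings: every cell is replaced by its rank with
respect to `cellKey`. -/
noncomputable def standardize (sh : Fin r → Finset (ℤ × ℤ)) (T : Fin r → ℤ × ℤ → ℕ) :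
    Fin r → ℤ × ℤ → ℕ := fun j c =>
  if c ∈ sh j then
    ((coloredCells sh).filter fun q => cellKey (T q.1 q.2) q ≤ cellKey (T j c) (j, c)).card
  else 0

theorem standardize_le {T : Fin r → ℤ × ℤ → ℕ} {p q : Fin r × ℤ × ℤ} (hq : q ∈ coloredCells sh)
    (h : cellKey (T p.1 p.2) p ≤ cellKey (T q.1 q.2) q) :
    standardize sh T p.1 p.2 ≤ standardize sh T q.1 q.2 := by
  rw [mem_coloredCells] at hq
  rw [standardize, standardize, if_pos hq]
  split_ifs
  · exact Finset.card_le_card (Finset.monotone_filter_right _ fun x _ hx => le_trans hx h)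
  · exact Nat.zero_le _

theorem standardize_lt {T : Fin r → ℤ × ℤ → ℕ} {p q : Fin r × ℤ × ℤ} (hp : p ∈ coloredCells sh)
    (hq : q ∈ coloredCells sh) (h : cellKey (T p.1 p.2) p < cellKey (T q.1 q.2) q) :
    standardize sh T p.1 p.2 < standardize sh T q.1 q.2 := by
  have hp' := mem_coloredCells.1 hp
  have hq' := mem_coloredCells.1 hq
  rw [standardize, standardize, if_pos hp', if_pos hq']
  refine Finset.card_lt_card (Finset.ssubset_iff_of_subset
    (Finset.monotone_filter_right _ fun x _ hx => le_trans hx h.le) |>.2 ⟨q, ?_, ?_⟩)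
  · exact Finset.mem_filter.2 ⟨hq, le_rfl⟩
  · exact fun h' => absurd (Finset.mem_filter.1 h').2 (not_le.2 h)

theorem isPartiteSYT_standardize {T : Fin r → ℤ × ℤ → ℕ}
    (hT : ∀ j, T j ∈ semistandardFillings (sh j)) (hcard : (coloredCells sh).card = n) :
    IsPartiteSYT sh n (standardize sh T) := by
  have hmaps : ∀ p ∈ coloredCells sh, standardize sh T p.1 p.2 ∈ Finset.Icc 1 n := by
    intro p hp
    rw [standardize, if_pos (mem_coloredCells.1 hp), Finset.mem_Icc, ← hcard]
    exact ⟨Finset.card_pos.2 ⟨p, Finset.mem_filter.2 ⟨hp, le_rfl⟩⟩,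
      Finset.card_le_card (Finset.filter_subset _ _)⟩
  have hinj : ∀ p ∈ coloredCells sh, ∀ q ∈ coloredCells sh,
      standardize sh T p.1 p.2 = standardize sh T q.1 q.2 → p = q := by
    intro p hp q hq h
    rcases lt_trichotomy (cellKey (T p.1 p.2) p) (cellKey (T q.1 q.2) q) with h' | h' | h'
    · exact absurd h (standardize_lt hp hq h').ne
    · exact cellKey_injective h'
    · exact absurd h (standardize_lt hq hp h').ne'
  have hsurj := Finset.surjOn_of_injOn_of_card_le (s := coloredCells sh) (t := Finset.Icc 1 n)
    (fun p => standardize sh T p.1 p.2) hmaps (fun p hp q hq h => hinj p hp q hq h)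
    (by simp [hcard])
  refine ⟨fun j c hc => if_neg hc, fun j c hc => hmaps (j, c) (mem_coloredCells.2 hc), ?_, ?_, ?_⟩
  · intro m hm
    obtain ⟨p, hp, rfl⟩ := hsurj hm
    exact ⟨p, ⟨mem_coloredCells.1 hp, rfl⟩, fun q hq =>
      hinj q (mem_coloredCells.2 hq.1) p hp hq.2⟩
  · intro j c hc hc'
    refine standardize_lt (p := (j, c)) (q := (j, (c.1, c.2 + 1))) (mem_coloredCells.2 hc)
      (mem_coloredCells.2 hc') (cellKey_lt_iff.2 ?_)
    exact ((hT j).2.1 c hc hc').lt_or_eq.imp id fun h => ⟨h, by simp⟩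
  · intro j c hc hc'
    refine standardize_lt (p := (j, c)) (q := (j, (c.1 + 1, c.2))) (mem_coloredCells.2 hc)
      (mem_coloredCells.2 hc') (cellKey_lt_iff.2 (Or.inl ((hT j).2.2 c hc hc')))

/-- The filling obtained from the standard tableau `Q` by replacing the entry `t + 1` by `i t`. -/
def destandardize (sh : Fin r → Finset (ℤ × ℤ)) (Q : Fin r → ℤ × ℤ → ℕ) (i : Fin n → ℕ) :
    Fin r → ℤ × ℤ → ℕ := fun j c =>
  if c ∈ sh j then (if h : Q j c - 1 < n then i ⟨Q j c - 1, h⟩ else 0) else 0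

theorem destandardize_reading (hpos : IsReading_s11 sh n Q pos) (i : Fin n → ℕ) {t : ℕ} (ht : t < n) :
    destandardize sh Q i (pos (t + 1)).1 (pos (t + 1)).2 = i ⟨t, ht⟩ := by
  have h := hpos.1 (t + 1) (by omega) ht
  rw [mem_coloredCells] at h
  simp [destandardize, h.1, h.2, ht]

theorem IsReading_s11.exists_eq (hpos : IsReading_s11 sh n Q pos) {p : Fin r × ℤ × ℤ}
    (hp : p ∈ coloredCells sh) : ∃ t < n, pos (t + 1) = p := by
  obtain ⟨h1, h2, h3⟩ := hpos.2 p hp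
  refine ⟨Q p.1 p.2 - 1, by omega, ?_⟩
  rwa [Nat.sub_add_cancel h1]

theorem IsReading_s11.sum_eq {M : Type*} [AddCommMonoid M] (hpos : IsReading_s11 sh n Q pos)
    (f : Fin r × ℤ × ℤ → M) :
    ∑ p ∈ coloredCells sh, f p = ∑ t : Fin n, f (pos (t + 1)) := by
  refine (Finset.sum_bij (fun (t : Fin n) _ => pos (t + 1)) (fun t _ => ?_) (fun t _ s _ h => ?_)
    (fun p hp => ?_) fun _ _ => rfl).symm
  · exact (hpos.1 _ (by omega) t.2).1
  · have h1 := (hpos.1 (t + 1) (by omega) t.2).2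
    have h2 := (hpos.1 (s + 1) (by omega) s.2).2
    rw [h, h2] at h1
    ext
    omega
  · obtain ⟨t, ht, rfl⟩ := hpos.exists_eq hp
    exact ⟨⟨t, ht⟩, Finset.mem_univ _, rfl⟩

theorem CompatibleSeq.cellKey_lt (hpos : IsReading_s11 sh n Q pos) {i : Fin n → ℕ}
    (hi : CompatibleSeq pos i) {p q : Fin r × ℤ × ℤ} (hp : p ∈ coloredCells sh)
    (hq : q ∈ coloredCells sh) (h : Q p.1 p.2 < Q q.1 q.2) :
    cellKey (destandardize sh Q i p.1 p.2) p < cellKey (destandardize sh Q i q.1 q.2) q := by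
  have key : ∀ a b (hab : a + 1 ≤ b) (hb : b < n),
      cellKey (i ⟨a, by omega⟩) (pos (a + 1)) < cellKey (i ⟨b, hb⟩) (pos (b + 1)) := by
    intro a b hab
    induction b, hab using Nat.le_induction with
    | base => exact fun hb => hi a hb
    | succ b hab ih => exact fun hb => (ih (by omega)).trans (hi b hb)
  obtain ⟨a, ha, rfl⟩ := hpos.exists_eq hp
  obtain ⟨b, hb, rfl⟩ := hpos.exists_eq hq
  rw [destandardize_reading hpos i ha, destandardize_reading hpos i hb]
  rw [(hpos.1 _ (by omega) ha).2, (hpos.1 _ (by omega) hb).2] at h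
  exact key a b (by omega) hb

theorem CompatibleSeq.destandardize_mem (hQ : IsPartiteSYT sh n Q) (hpos : IsReading_s11 sh n Q pos)
    {i : Fin n → ℕ} (hi : CompatibleSeq pos i) (j : Fin r) :
    destandardize sh Q i j ∈ semistandardFillings (sh j) := by
  refine ⟨fun c hc => if_neg hc, fun c hc hc' => ?_, fun c hc hc' => ?_⟩
  · have h := hi.cellKey_lt hpos (p := (j, c)) (q := (j, (c.1, c.2 + 1))) (by simpa using hc)
      (by simpa using hc') (hQ.2.2.2.1 j c hc hc')
    rcases cellKey_lt_iff.1 h with h' | h'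
    · exact h'.le
    · exact h'.1.le
  · have h := hi.cellKey_lt hpos (p := (j, c)) (q := (j, (c.1 + 1, c.2))) (by simpa using hc)
      (by simpa using hc') (hQ.2.2.2.2 j c hc hc')
    rcases cellKey_lt_iff.1 h with h' | ⟨-, h' | ⟨-, h' | ⟨h', -⟩⟩⟩
    · exact h'
    · simp at h'
    · simp at h'
    · simp at h'

theorem CompatibleSeq.standardize_destandardize (hQ : IsPartiteSYT sh n Q)
    (hpos : IsReading_s11 sh n Q pos) {i : Fin n → ℕ} (hi : CompatibleSeq pos i) :
    standardize sh (destandardize sh Q i) = Q := by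
  ext j c
  by_cases hc : c ∈ sh j
  · have hp : (j, c) ∈ coloredCells sh := mem_coloredCells.2 hc
    have hQp := hpos.2 _ hp
    dsimp only at hQp
    rw [standardize, if_pos hc]
    have hfilter : ∀ q ∈ coloredCells sh, (cellKey (destandardize sh Q i q.1 q.2) q ≤
        cellKey (destandardize sh Q i j c) (j, c) ↔ Q q.1 q.2 ≤ Q j c) := by
      intro q hq
      constructor
      · intro h
        by_contra! h'
        exact absurd (hi.cellKey_lt hpos hp hq h') (not_lt.2 h)
      · intro h
        rcases lt_or_eq_of_le h with h' | h'
        · exact (hi.cellKey_lt hpos hq hp h').le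
        · have : q = (j, c) := by rw [← (hpos.2 q hq).2.2, h', hQp.2.2]
          rw [this]
    rw [Finset.filter_congr hfilter]
    refine (Finset.card_nbij' (t := Finset.Icc 1 (Q j c)) (fun q => Q q.1 q.2) pos
      ?_ ?_ ?_ ?_).trans (by simp)
    · intro q hq
      obtain ⟨hq, hle⟩ := Finset.mem_filter.1 hq
      exact Finset.mem_coe.2 (Finset.mem_Icc.2 ⟨(hpos.2 q hq).1, hle⟩)
    · intro m hm
      obtain ⟨h1, h2⟩ := Finset.mem_Icc.1 hm
      obtain ⟨h3, h4⟩ := hpos.1 m h1 (by omega)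
      exact Finset.mem_coe.2 (Finset.mem_filter.2 ⟨h3, by rwa [h4]⟩)
    · intro q hq
      exact (hpos.2 q (Finset.mem_filter.1 hq).1).2.2
    · intro m hm
      obtain ⟨h1, h2⟩ := Finset.mem_Icc.1 hm
      exact (hpos.1 m h1 (by omega)).2
  · rw [standardize, if_neg hc, hQ.1 j c hc]

theorem destandardize_injective (hpos : IsReading_s11 sh n Q pos) :
    Function.Injective (destandardize sh Q : (Fin n → ℕ) → _) := by
  intro i i' h
  ext t
  rw [← destandardize_reading hpos i t.2, h, destandardize_reading hpos i' t.2]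

theorem exists_compatibleSeq {T : Fin r → ℤ × ℤ → ℕ} (hT : ∀ j, ∀ c ∉ sh j, T j c = 0)
    (hpos : IsReading_s11 sh n Q pos) (hTQ : standardize sh T = Q) :
    ∃ i : Fin n → ℕ, CompatibleSeq pos i ∧ destandardize sh Q i = T := by
  refine ⟨fun t => T (pos (t + 1)).1 (pos (t + 1)).2, ?_, ?_⟩
  · intro t ht
    by_contra! h
    have ha := hpos.1 (t + 1) (by omega) (by omega)
    have hb := hpos.1 (t + 2) (by omega) (by omega)
    have := standardize_le (T := T) ha.1 h
    rw [hTQ, ha.2, hb.2] at this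
    omega
  · ext j c
    by_cases hc : c ∈ sh j
    · obtain ⟨t, ht, h⟩ := hpos.exists_eq (p := (j, c)) (mem_coloredCells.2 hc)
      have := destandardize_reading hpos (fun t : Fin n => T (pos (t + 1)).1 (pos (t + 1)).2) ht
      simpa only [h] using this
    · rw [hT j c hc]
      exact if_neg hc

/-- The semistandard fillings standardizing to `Q` are counted by the fundamental
quasisymmetric function of `Q`. -/
theorem ncard_fiber_standardize [NeZero r] (hn : 0 < n) (hQ : IsPartiteSYT sh n Q)
    (hsh : RowConvex sh) (d : Fin r × ℕ →₀ ℕ) :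
    ({T : Fin r → ℤ × ℤ → ℕ | ((∀ j, T j ∈ semistandardFillings (sh j)) ∧
      ∑ j, ∑ c ∈ sh j, Finsupp.single (j, T j c) 1 = d) ∧ standardize sh T = Q}.ncard : ℤ) =
      MvPowerSeries.coeff d (Fcol n (coTab sh n Q)) := by
  obtain ⟨pos, hpos⟩ := hQ.exists_isReading
  rw [coeff_Fcol_coTab hn hQ hsh hpos,
    ← Set.ncard_image_of_injective _ (destandardize_injective hpos)]
  congr 2
  have hweight : ∀ i : Fin n → ℕ,
      ∑ j, ∑ c ∈ sh j, Finsupp.single (j, destandardize sh Q i j c) 1 =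
        ∑ t : Fin n, Finsupp.single ((pos (t + 1)).1, i t) 1 := by
    intro i
    rw [← sum_coloredCells sh fun p => Finsupp.single (p.1, destandardize sh Q i p.1 p.2) 1,
      hpos.sum_eq]
    refine Finset.sum_congr rfl fun t _ => ?_
    rw [destandardize_reading hpos i t.2]
  ext T
  constructor
  · rintro ⟨⟨hT, hd⟩, hTQ⟩
    obtain ⟨i, hi, rfl⟩ := exists_compatibleSeq (fun j => (hT j).1) hpos hTQ
    exact ⟨i, ⟨hi, by rw [← hweight, hd]⟩, rfl⟩
  · rintro ⟨i, ⟨hi, hd⟩, rfl⟩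
    exact ⟨⟨hi.destandardize_mem hQ hpos, by rw [hweight, hd]⟩, hi.standardize_destandardize hQ hpos⟩

theorem finite_isPartiteSYT (sh : Fin r → Finset (ℤ × ℤ)) (n : ℕ) :
    {Q : Fin r → ℤ × ℤ → ℕ | IsPartiteSYT sh n Q}.Finite := by
  refine (Set.Finite.pi' fun j => finite_bounded_fillings (sh j) n).subset fun Q hQ j => ?_
  exact ⟨hQ.1 j, fun c hc => (Finset.mem_Icc.1 (hQ.2.1 j c hc)).2⟩

theorem prod_skewSchurIn_eq_finsum [NeZero r] (hn : 0 < n) (hsh : RowConvex sh)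
    (hcard : (coloredCells sh).card = n) :
    (∏ j, skewSchurIn j (sh j)) =
      ∑ᶠ Q ∈ {Q : Fin r → ℤ × ℤ → ℕ | IsPartiteSYT sh n Q}, Fcol n (coTab sh n Q) := by
  classical
  ext d
  obtain ⟨hfin, hcoeff⟩ := coeff_prod_ncard (fun j => semistandardFillings (sh j))
    (fun j T => ∑ c ∈ sh j, Finsupp.single (j, T c) 1)
    (fun j e => (finite_fillings_of_weight j (sh j) e).subset fun T hT => ⟨hT.1.1, hT.2⟩)
    (fun j => skewSchurIn j (sh j))
    (fun j e => by
      change ((Set.ncard _ : ℕ) : ℤ) = _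
      congr 2
      ext T
      simp only [semistandardFillings, Set.mem_ofPred_eq, and_assoc]) d
  rw [hcoeff, finsum_mem_eq_finite_toFinset_sum _ (finite_isPartiteSYT sh n), map_sum,
    Set.ncard_eq_toFinset_card _ hfin,
    Finset.card_eq_sum_card_fiberwise (f := standardize sh)
      (t := (finite_isPartiteSYT sh n).toFinset)]
  · push_cast
    refine Finset.sum_congr rfl fun Q hQ => ?_
    rw [Set.Finite.mem_toFinset] at hQ
    rw [← ncard_fiber_standardize hn hQ hsh d, ← Set.ncard_coe_finset]
    congr 2
    ext T
    simp
  · intro T hT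
    rw [Finset.mem_coe, Set.Finite.mem_toFinset] at hT ⊢
    exact isPartiteSYT_standardize hT.1 hcard

end

theorem rowConvex_shOf {r : ℕ} (lam : Fin r → YoungDiagram) : RowConvex (shOf lam) := by
  intro j a b b' x hb hb' h1 h2
  simp only [shOf, Finset.mem_image, Prod.mk.injEq] at *
  obtain ⟨c, -, -, rfl⟩ := hb
  obtain ⟨c', hc', rfl, rfl⟩ := hb'
  exact ⟨(c'.1, x.toNat), (lam j).up_left_mem le_rfl (by omega) hc', rfl, by simp; omega⟩

theorem card_shOf {r : ℕ} (lam : Fin r → YoungDiagram) (j : Fin r) :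
    (shOf lam j).card = (lam j).card :=
  Finset.card_image_of_injective _ fun c c' h => by
    simpa [Prod.ext_iff] using h

/-- For every `r`-partite partition `𝛌` of `n` (given as a
tuple of Young diagrams of total size `n`), the colored Schur function
satisfies `s_𝛌 = Σ_{Q ∈ SYT(𝛌)} F^{(r)}_{co(Q)}`, where the sum is over all
standard Young `r`-partite tableaux of shape `𝛌` and `co(Q)` is the colored
descent composition of `Q`. -/
theorem statement11 (n r : ℕ) (hn : 0 < n) [NeZero r]
    (lam : Fin r → YoungDiagram) (hcard : ∑ j, (lam j).card = n) :
    (∏ j, skewSchurIn j (shOf lam j)) =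
      ∑ᶠ T ∈ {T : Fin r → ℤ × ℤ → ℕ | IsPartiteSYT (shOf lam) n T},
        Fcol n (coTab (shOf lam) n T) := by
  exact prod_skewSchurIn_eq_finsum hn (rowConvex_shOf lam)
    (by simp only [card_coloredCells, card_shOf, hcard])
end
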